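/- arXiv:0801.0394 — 2 statements merged into one kernel-verified Lean document; each statement's English description precedes it below -/
import Mathlib

section
/- There exists a positive integer n₀ such that every regular tournament on n ≥ n₀ vertices contains at least n/8 pairwise edge-disjoint Hamilton cycles. -/
open Set

namespace ArxivOG

variable {V : Type*}

/-- An oriented graph: at most one directed edge between any two vertices (and no loops). -/
def IsOriented (G : V → V → Prop) : Prop := ∀ x y : V, G x y → ¬ G y x

/-- Out-neighbourhood of a vertex. -/
def outN (G : V → V → Prop) (x : V) : Set V := {y | G x y}

/-- In-neighbourhood of a vertex. -/
def inN (G : V → V → Prop) (x : V) : Set V := {y | G y x}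

/-- Outdegree of a vertex. -/
noncomputable def outDeg (G : V → V → Prop) (x : V) : ℕ := (outN G x).ncard

/-- Indegree of a vertex. -/
noncomputable def inDeg (G : V → V → Prop) (x : V) : ℕ := (inN G x).ncard

/-- The set of all outneighbours of vertices in `S`. -/
def outNSet (G : V → V → Prop) (S : Set V) : Set V := {y | ∃ x ∈ S, G x y}

/-- Minimum outdegree `δ⁺`. -/
noncomputable def minOutDeg (G : V → V → Prop) : ℕ := sInf (Set.range (outDeg G))

/-- Minimum indegree `δ⁻`. -/
noncomputable def minInDeg (G : V → V → Prop) : ℕ := sInf (Set.range (inDeg G))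

/-- Minimum semi-degree `δ⁰ = min (δ⁺, δ⁻)`. -/
noncomputable def minSemiDeg (G : V → V → Prop) : ℕ := min (minOutDeg G) (minInDeg G)

/-- A Hamilton cycle of a digraph, encoded as a permutation `σ` of the vertex set all of whose
vertices lie on a single cycle and such that every vertex sends an edge to its successor. -/
def IsHamCycle (G : V → V → Prop) (σ : Equiv.Perm V) : Prop :=
  (∀ v, G v (σ v)) ∧ ∀ v w : V, σ.SameCycle v w

/-- The number of edges directed from `A` to `B`. -/
noncomputable def eCnt (G : V → V → Prop) (A B : Set V) : ℕ :=
  {p : V × V | p.1 ∈ A ∧ p.2 ∈ B ∧ G p.1 p.2}.ncard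

/-- The density of the bipartite graph of all `A`–`B` edges. -/
noncomputable def dens (G : V → V → Prop) (A B : Set V) : ℝ :=
  (eCnt G A B : ℝ) / ((A.ncard : ℝ) * (B.ncard : ℝ))

/-- The pair `(A,B)` is `ε`-regular. -/
def EpsRegular (ε : ℝ) (G : V → V → Prop) (A B : Set V) : Prop :=
  ∀ X ⊆ A, ∀ Y ⊆ B, ε * A.ncard < (X.ncard : ℝ) → ε * B.ncard < (Y.ncard : ℝ) →
    |dens G X Y - dens G A B| < ε

/-- The pair `(A,B)` is `(ε,d)`-super-regular. -/
def SuperRegular (ε d : ℝ) (G : V → V → Prop) (A B : Set V) : Prop :=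
  EpsRegular ε G A B ∧
  (∀ a ∈ A, (d - ε) * B.ncard ≤ ((outN G a ∩ B).ncard : ℝ)) ∧
  (∀ b ∈ B, (d - ε) * A.ncard ≤ ((inN G b ∩ A).ncard : ℝ))

/-- The cluster `V_i` of a partition encoded by `P : V → Option (Fin k)`. -/
def cluster {k : ℕ} (P : V → Option (Fin k)) (i : Fin k) : Set V := {x | P x = some i}

/-- The exceptional set `V₀` of a partition encoded by `P : V → Option (Fin k)`. -/
def cluster0 {k : ℕ} (P : V → Option (Fin k)) : Set V := {x | P x = none}

section
open scoped Classical

theorem sameCycle_mul_swap [Fintype V] (σ : Equiv.Perm V) {x z : V} (h : ¬ σ.SameCycle x z) :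
    (σ * Equiv.swap x z).SameCycle x z ∧
      ∀ u v, σ.SameCycle u v → (σ * Equiv.swap x z).SameCycle u v := by
  set τ := σ * Equiv.swap x z with hτ
  have hτx : τ x = σ z := by simp [hτ]
  have hτz : τ z = σ x := by simp [hτ]
  have hne : ∀ v, v ≠ x → v ≠ z → τ v = σ v := fun v h1 h2 => by
    simp [hτ, Equiv.swap_apply_of_ne_of_ne h1 h2]
  have h1 : ∀ j : ℕ, τ.SameCycle x ((σ ^ (j + 1)) z) := by
    intro j
    induction j with
    | zero => rw [zero_add, pow_one, ← hτx]; exact ⟨1, by simp⟩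
    | succ j ih =>
      have e : (σ ^ (j + 1 + 1)) z = σ ((σ ^ (j + 1)) z) := by rw [pow_succ']; rfl
      rw [e]
      by_cases hz : (σ ^ (j + 1)) z = z
      · rw [hz, ← hτx]; exact ⟨1, by simp⟩
      · have hx : (σ ^ (j + 1)) z ≠ x := fun hx =>
          h (Equiv.Perm.SameCycle.symm ⟨((j + 1 : ℕ) : ℤ), by rw [zpow_natCast]; exact hx⟩)
        rw [← hne _ hx hz]
        exact ih.trans ⟨1, by simp⟩
  have hxz : τ.SameCycle x z := by
    have := h1 (orderOf σ - 1)
    rwa [Nat.sub_add_cancel (orderOf_pos σ), pow_orderOf_eq_one] at this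
  have hstep : ∀ v, τ.SameCycle v (σ v) := by
    intro v
    by_cases hx : v = x
    · subst hx; rw [← hτz]; exact hxz.trans ⟨1, by simp⟩
    by_cases hz : v = z
    · subst hz; rw [← hτx]; exact hxz.symm.trans ⟨1, by simp⟩
    rw [← hne v hx hz]; exact ⟨1, by simp⟩
  refine ⟨hxz, ?_⟩
  intro u v huv
  obtain ⟨i, rfl⟩ := huv.exists_nat_pow_eq
  induction i with
  | zero => simp [Equiv.Perm.SameCycle.refl]
  | succ j ih =>
    rw [pow_succ']
    exact (ih ⟨j, by simp⟩).trans (hstep _)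

theorem exists_perm_unite [Fintype V] (σ : Equiv.Perm V) (R : Finset V) :
    ∃ τ : Equiv.Perm V, (∀ v ∉ R, τ v = σ v) ∧ (∀ u v, σ.SameCycle u v → τ.SameCycle u v) ∧
      ∀ u ∈ R, ∀ v ∈ R, τ.SameCycle u v := by
  induction R using Finset.induction_on with
  | empty => exact ⟨σ, by simp, fun _ _ h => h, by simp⟩
  | insert r R hr ih =>
    obtain ⟨τ, h1, h2, h3⟩ := ih
    obtain rfl | ⟨s, hs⟩ := R.eq_empty_or_nonempty
    · exact ⟨τ, fun v _ => h1 v (by simp), h2, by simp [Equiv.Perm.SameCycle.refl]⟩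
    by_cases hrs : τ.SameCycle r s
    · refine ⟨τ, fun v hv => h1 v (fun h => hv (Finset.mem_insert_of_mem h)), h2, ?_⟩
      have key : ∀ u ∈ insert r R, τ.SameCycle u s := by
        intro u hu
        rcases Finset.mem_insert.1 hu with rfl | hu
        · exact hrs
        · exact h3 u hu s hs
      exact fun u hu v hv => (key u hu).trans (key v hv).symm
    · obtain ⟨m1, m2⟩ := sameCycle_mul_swap τ hrs
      refine ⟨τ * Equiv.swap r s, ?_, fun u v h => m2 u v (h2 u v h), ?_⟩
      · intro v hv
        rw [Finset.mem_insert, not_or] at hv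
        rw [Equiv.Perm.mul_apply, Equiv.swap_apply_of_ne_of_ne hv.1 (fun h => hv.2 (h ▸ hs))]
        exact h1 v hv.2
      · have key : ∀ u ∈ insert r R, (τ * Equiv.swap r s).SameCycle u s := by
          intro u hu
          rcases Finset.mem_insert.1 hu with rfl | hu
          · exact m1
          · exact m2 _ _ (h3 u hu s hs)
        exact fun u hu v hv => (key u hu).trans (key v hv).symm

/-- Insert the fixed points `w j`, `w' j` consecutively after `p j`, for all `j ∈ J`. -/
theorem exists_perm_insert [Fintype V] {ι : Type*} (σ : Equiv.Perm V) (p w w' : ι → V)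
    (J : Finset ι) (hp : ∀ i ∈ J, ∀ j ∈ J, p i = p j → i = j)
    (hw : ∀ i ∈ J, ∀ j ∈ J, w i = w j → i = j)
    (hw' : ∀ i ∈ J, ∀ j ∈ J, w' i = w' j → i = j)
    (hww' : ∀ i ∈ J, ∀ j ∈ J, w i ≠ w' j)
    (hpw : ∀ i ∈ J, ∀ j ∈ J, p i ≠ w j) (hpw' : ∀ i ∈ J, ∀ j ∈ J, p i ≠ w' j)
    (hfw : ∀ j ∈ J, σ (w j) = w j) (hfw' : ∀ j ∈ J, σ (w' j) = w' j) :
    ∃ τ : Equiv.Perm V,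
      (∀ j ∈ J, τ (p j) = w j ∧ τ (w j) = w' j ∧ τ (w' j) = σ (p j)) ∧
      (∀ v, (∀ j ∈ J, v ≠ p j ∧ v ≠ w j ∧ v ≠ w' j) → τ v = σ v) ∧
      (∀ u v, σ.SameCycle u v → τ.SameCycle u v) := by
  induction J using Finset.induction_on with
  | empty => exact ⟨σ, by simp, by simp, fun _ _ h => h⟩
  | insert i J hi ih =>
    have sub : ∀ j ∈ J, j ∈ insert i J := fun j hj => Finset.mem_insert_of_mem hj
    have ii : i ∈ insert i J := Finset.mem_insert_self _ _
    obtain ⟨τ, t1, t2, t3⟩ := ih (fun a ha b hb => hp a (sub a ha) b (sub b hb))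
      (fun a ha b hb => hw a (sub a ha) b (sub b hb))
      (fun a ha b hb => hw' a (sub a ha) b (sub b hb))
      (fun a ha b hb => hww' a (sub a ha) b (sub b hb))
      (fun a ha b hb => hpw a (sub a ha) b (sub b hb))
      (fun a ha b hb => hpw' a (sub a ha) b (sub b hb))
      (fun a ha => hfw a (sub a ha)) (fun a ha => hfw' a (sub a ha))
    have ne : ∀ j ∈ J, j ≠ i := fun j hj h => hi (h ▸ hj)
    have ep : τ (p i) = σ (p i) := t2 _ fun j hj =>
      ⟨fun h => ne j hj (hp i ii j (sub j hj) h).symm, hpw i ii j (sub j hj),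
        hpw' i ii j (sub j hj)⟩
    have ew : τ (w i) = w i := (t2 _ fun j hj =>
      ⟨fun h => hpw j (sub j hj) i ii h.symm,
        fun h => ne j hj (hw i ii j (sub j hj) h).symm, hww' i ii j (sub j hj)⟩).trans (hfw i ii)
    have ew' : τ (w' i) = w' i := (t2 _ fun j hj =>
      ⟨fun h => hpw' j (sub j hj) i ii h.symm, fun h => hww' j (sub j hj) i ii h.symm,
        fun h => ne j hj (hw' i ii j (sub j hj) h).symm⟩).trans (hfw' i ii)
    have n1 := hpw i ii i ii
    have n2 := hpw' i ii i ii
    have n3 := hww' i ii i ii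
    have notfix : ∀ (π : Equiv.Perm V) (x y : V), π y = y → x ≠ y → ¬ π.SameCycle x y := by
      intro π x y hy hxy h
      obtain ⟨k, hk⟩ := h.symm
      exact hxy (hk.symm.trans (Equiv.Perm.zpow_apply_eq_self_of_apply_eq_self hy k))
    obtain ⟨-, m2⟩ := sameCycle_mul_swap τ (notfix τ (p i) (w' i) ew' n2)
    set τ₁ := τ * Equiv.swap (p i) (w' i) with hτ₁
    have ew1 : τ₁ (w i) = w i := by
      rw [hτ₁, Equiv.Perm.mul_apply, Equiv.swap_apply_of_ne_of_ne n1.symm n3, ew]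
    obtain ⟨-, m4⟩ := sameCycle_mul_swap τ₁ (notfix τ₁ (p i) (w i) ew1 n1)
    refine ⟨τ₁ * Equiv.swap (p i) (w i), ?_, ?_, fun u v h => m4 _ _ (m2 _ _ (t3 u v h))⟩
    · intro j hj
      rcases Finset.mem_insert.1 hj with rfl | hj
      · refine ⟨?_, ?_, ?_⟩
        · simp [ew1]
        · simp [hτ₁, ew']
        · simp [hτ₁, Equiv.swap_apply_of_ne_of_ne n2.symm n3.symm, ep]
      · have q : ∀ v, v ≠ p i → v ≠ w i → v ≠ w' i →
            (τ₁ * Equiv.swap (p i) (w i)) v = τ v := by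
          intro v v1 v2 v3
          simp [hτ₁, Equiv.swap_apply_of_ne_of_ne v1 v2, Equiv.swap_apply_of_ne_of_ne v1 v3]
        rw [q (p j) (fun h => ne j hj (hp j (sub j hj) i ii h)) (hpw j (sub j hj) i ii)
          (hpw' j (sub j hj) i ii),
          q (w j) (fun h => hpw i ii j (sub j hj) h.symm)
          (fun h => ne j hj (hw j (sub j hj) i ii h)) (hww' j (sub j hj) i ii),
          q (w' j) (fun h => hpw' i ii j (sub j hj) h.symm)
          (fun h => hww' i ii j (sub j hj) h.symm)
          (fun h => ne j hj (hw' j (sub j hj) i ii h))]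
        exact t1 j hj
    · intro v hv
      obtain ⟨v1, v2, v3⟩ := hv i ii
      simp [hτ₁, Equiv.swap_apply_of_ne_of_ne v1 v2, Equiv.swap_apply_of_ne_of_ne v1 v3]
      exact t2 v fun j hj => hv j (sub j hj)

theorem girth_of_reroute (σ τ : Equiv.Perm V) (g : ℕ) (W M : Finset V)
    (hne : ∀ v ∉ M, τ v = σ v) (hM : ∀ p ∈ M, ∃ q ∈ M, q ≠ p ∧ τ p = σ q)
    (hsep : ∀ p ∈ M, ∀ q ∈ M, p ≠ q → ∀ j < g, (σ ^ j) p ≠ q) (hMW : ∀ p ∈ M, p ∉ W)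
    (hgirth : ∀ v ∉ W, ∀ j, 1 ≤ j → j < g → (σ ^ j) v ≠ v) :
    ∀ v ∉ W, ∀ j, 1 ≤ j → j < g → (τ ^ j) v ≠ v := by
  intro v hv j h1 hj hτ
  by_cases hex : ∃ i < j, (τ ^ i) v ∈ M
  · obtain ⟨i, -, hi⟩ := hex
    set p := (τ ^ i) v with hp
    have hpp : (τ ^ j) p = p := by
      rw [hp, ← Equiv.Perm.mul_apply, ← pow_add, add_comm, pow_add, Equiv.Perm.mul_apply, hτ]
    obtain ⟨q, hq, hqp, hpq⟩ := hM p hi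
    have key : ∀ i, i + 1 ≤ j → (τ ^ (i + 1)) p = (σ ^ (i + 1)) q := by
      intro i
      induction i with
      | zero => intro _; simpa using hpq
      | succ i ih =>
        intro hi
        rw [pow_succ', Equiv.Perm.mul_apply, ih (by omega), pow_succ' σ (i + 1),
          Equiv.Perm.mul_apply]
        apply hne
        intro hm
        by_cases hqq : (σ ^ (i + 1)) q = q
        · exact hgirth q (hMW q hq) (i + 1) (by omega) (by omega) hqq
        · exact hsep q hq _ hm (Ne.symm hqq) (i + 1) (by omega) rfl
    have := key (j - 1) (by omega)
    rw [Nat.sub_add_cancel h1, hpp] at this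
    exact hsep q hq p hi hqp j hj this.symm
  · push Not at hex
    have key : ∀ i, i ≤ j → (τ ^ i) v = (σ ^ i) v := by
      intro i
      induction i with
      | zero => simp
      | succ i ih =>
        intro hi
        rw [pow_succ', Equiv.Perm.mul_apply, hne _ (hex i (by omega)), ih (by omega), pow_succ',
          Equiv.Perm.mul_apply]
    exact hgirth v hv j h1 hj ((key j le_rfl).symm.trans hτ)

/-- `E` is a lower bound for the number of edges between any two sets of at least `δ` vertices. -/
def ManyEdges [Fintype V] (D : V → V → Prop) (δ E : ℕ) : Prop :=
  ∀ S T : Finset V, δ ≤ S.card → δ ≤ T.card →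
    E ≤ ((S ×ˢ T).filter fun p => D p.1 p.2).card

theorem exists_exchange [Fintype V] (D : V → V → Prop) (δ E g : ℕ) (Φ : Finset V)
    (hout : ∀ v, δ ≤ (Finset.univ.filter fun u => D v u).card)
    (hin : ∀ v, δ ≤ (Finset.univ.filter fun u => D u v).card)
    (hE : ManyEdges D δ E) (hg : (6 * g + 2 * Φ.card) * Fintype.card V < E)
    (σ : Equiv.Perm V) (z : V) :
    ∃ u u', D z (σ u) ∧ D u (σ u') ∧ D u' (σ z) ∧ u ∉ Φ ∧ u' ∉ Φ ∧
      (∀ j < g, (σ ^ j) z ≠ u ∧ (σ ^ j) u ≠ z) ∧ (∀ j < g, (σ ^ j) z ≠ u' ∧ (σ ^ j) u' ≠ z) ∧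
      (∀ j < g, (σ ^ j) u ≠ u' ∧ (σ ^ j) u' ≠ u) := by
  set N : V → Finset V := fun a => (Finset.range g).image (fun j => (σ ^ j) a) ∪
    (Finset.range g).image (fun j => (σ ^ j)⁻¹ a) with hN
  have hNc : ∀ a, (N a).card ≤ 2 * g := by
    intro a
    refine (Finset.card_union_le _ _).trans ?_
    have h1 := Finset.card_image_le (s := Finset.range g) (f := fun j => (σ ^ j) a)
    have h2 := Finset.card_image_le (s := Finset.range g) (f := fun j => (σ ^ j)⁻¹ a)
    rw [Finset.card_range] at h1 h2
    omega
  have hNm : ∀ a b, b ∉ N a → ∀ j < g, (σ ^ j) a ≠ b ∧ (σ ^ j) b ≠ a := by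
    intro a b hb j hj
    simp only [hN, Finset.mem_union, Finset.mem_image, Finset.mem_range, not_or, not_exists,
      not_and] at hb
    refine ⟨hb.1 j hj, fun h => hb.2 j hj ?_⟩
    rw [← h]; simp
  set S := Finset.univ.filter fun u => D z (σ u)
  set T := Finset.univ.filter fun t => D (σ⁻¹ t) (σ z)
  have hS : δ ≤ S.card := by
    refine (hout z).trans (le_of_eq ?_)
    refine Finset.card_bij' (fun u _ => σ⁻¹ u) (fun u _ => σ u) ?_ ?_ ?_ ?_ <;> simp [S]
  have hT : δ ≤ T.card := by
    refine (hin (σ z)).trans (le_of_eq ?_)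
    refine Finset.card_bij' (fun u _ => σ u) (fun u _ => σ⁻¹ u) ?_ ?_ ?_ ?_ <;> simp [T]
  set P := ((S ×ˢ T).filter fun p => D p.1 p.2).image fun p => (p.1, σ⁻¹ p.2) with hP
  have hPc : E ≤ P.card := by
    rw [hP, Finset.card_image_of_injective]
    · exact hE S T hS hT
    · rintro ⟨a, b⟩ ⟨c, d⟩ h
      simpa using h
  set X : Finset (V × V) := (Φ ×ˢ Finset.univ) ∪ (Finset.univ ×ˢ Φ) ∪ (N z ×ˢ Finset.univ) ∪
    (Finset.univ ×ˢ N z) ∪ Finset.univ.biUnion (fun a => (N a).image fun b => (a, b)) with hX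
  have hXc : X.card ≤ (6 * g + 2 * Φ.card) * Fintype.card V := by
    have hz := Nat.mul_le_mul_right (Fintype.card V) (hNc z)
    have h5 : (Finset.univ.biUnion (fun a => (N a).image fun b => (a, b))).card
        ≤ Fintype.card V * (2 * g) := by
      refine Finset.card_biUnion_le.trans ?_
      rw [← Finset.card_univ, ← smul_eq_mul]
      exact Finset.sum_le_card_nsmul _ _ _ fun a _ => Finset.card_image_le.trans (hNc a)
    refine (Finset.card_union_le _ _).trans ?_
    refine (Nat.add_le_add_right (Finset.card_union_le _ _) _).trans ?_
    refine (Nat.add_le_add_right (Nat.add_le_add_right (Finset.card_union_le _ _) _) _).trans ?_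
    refine (Nat.add_le_add_right (Nat.add_le_add_right (Nat.add_le_add_right
      (Finset.card_union_le _ _) _) _) _).trans ?_
    simp only [Finset.card_product, Finset.card_univ]
    nlinarith
  obtain ⟨⟨u, u'⟩, hp, hx⟩ := Finset.exists_mem_notMem_of_card_lt_card
    (lt_of_le_of_lt hXc (lt_of_lt_of_le hg hPc))
  simp only [hP, Finset.mem_image, Finset.mem_filter, Finset.mem_product, Prod.mk.injEq,
    Prod.exists, S, T, Finset.mem_univ, true_and] at hp
  obtain ⟨a, b, ⟨⟨h1, h2⟩, h3⟩, rfl, rfl⟩ := hp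
  simp only [hX, Finset.mem_union, Finset.mem_product, Finset.mem_univ, and_true, true_and,
    Finset.mem_biUnion, Finset.mem_image, Prod.mk.injEq, not_or, not_exists, not_and] at hx
  obtain ⟨⟨⟨⟨x1, x2⟩, x3⟩, x4⟩, x5⟩ := hx
  refine ⟨a, σ⁻¹ b, h1, by simpa using h3, h2, x1, x2, hNm z a x3, hNm z _ x4, hNm a _ ?_⟩
  exact fun h => x5 a _ h rfl rfl

theorem exists_perm_eliminate [Fintype V] (D : V → V → Prop) (δ E g : ℕ) (W Φ : Finset V)
    (hWΦ : W ⊆ Φ) (hg1 : 1 ≤ g)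
    (hout : ∀ v, δ ≤ (Finset.univ.filter fun u => D v u).card)
    (hin : ∀ v, δ ≤ (Finset.univ.filter fun u => D u v).card)
    (hE : ManyEdges D δ E) (hg : (6 * g + 2 * Φ.card) * Fintype.card V < E) (m : ℕ) :
    ∀ (σ : Equiv.Perm V), (∀ v ∉ W, ∀ j, 1 ≤ j → j < g → (σ ^ j) v ≠ v) →
      (Finset.univ.filter fun v => v ∉ Φ ∧ ¬ D v (σ v)).card ≤ m →
    ∃ τ : Equiv.Perm V, (∀ v ∈ Φ, τ v = σ v) ∧ (∀ v ∉ Φ, D v (τ v)) ∧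
      (∀ v ∉ W, ∀ j, 1 ≤ j → j < g → (τ ^ j) v ≠ v) ∧
      (Finset.univ.filter fun v => τ v ≠ σ v).card ≤ 3 * m := by
  induction m with
  | zero =>
    intro σ hσ h0
    refine ⟨σ, fun _ _ => rfl, fun v hv => ?_, hσ, by simp⟩
    by_contra hD
    have : v ∈ Finset.univ.filter fun v => v ∉ Φ ∧ ¬ D v (σ v) := by simp [hv, hD]
    rw [Finset.card_eq_zero.1 (Nat.le_zero.1 h0)] at this
    simp at this
  | succ m ih =>
    intro σ hσ hm
    by_cases hall : ∀ v ∉ Φ, D v (σ v)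
    · exact ⟨σ, fun _ _ => rfl, hall, hσ, by simp⟩
    push Not at hall
    obtain ⟨z, hz, hDz⟩ := hall
    obtain ⟨u, u', d1, d2, d3, hu, hu', s1, s2, s3⟩ :=
      exists_exchange D δ E g Φ hout hin hE hg σ z
    have zu : z ≠ u := by simpa using (s1 0 hg1).1
    have zu' : z ≠ u' := by simpa using (s2 0 hg1).1
    have uu' : u ≠ u' := by simpa using (s3 0 hg1).1
    set π := σ * (Equiv.swap z u * Equiv.swap u u') with hπ
    have πz : π z = σ u := by
      simp [hπ, Equiv.swap_apply_of_ne_of_ne zu zu']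
    have πu : π u = σ u' := by
      simp [hπ, Equiv.swap_apply_of_ne_of_ne zu'.symm uu'.symm]
    have πu' : π u' = σ z := by simp [hπ]
    have πne : ∀ v, v ≠ z → v ≠ u → v ≠ u' → π v = σ v := by
      intro v h1 h2 h3
      simp [hπ, Equiv.swap_apply_of_ne_of_ne h1 h2, Equiv.swap_apply_of_ne_of_ne h2 h3]
    have πΦ : ∀ v ∈ Φ, π v = σ v := fun v hv => πne v (fun h => hz (h ▸ hv))
      (fun h => hu (h ▸ hv)) (fun h => hu' (h ▸ hv))
    have πg : ∀ v ∉ W, ∀ j, 1 ≤ j → j < g → (π ^ j) v ≠ v := by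
      refine girth_of_reroute σ π g W {z, u, u'} ?_ ?_ ?_ ?_ hσ
      · intro v hv
        simp only [Finset.mem_insert, Finset.mem_singleton, not_or] at hv
        exact πne v hv.1 hv.2.1 hv.2.2
      · intro p hp
        simp only [Finset.mem_insert, Finset.mem_singleton] at hp
        rcases hp with rfl | rfl | rfl
        · exact ⟨u, by simp, zu.symm, πz⟩
        · exact ⟨u', by simp, uu'.symm, πu⟩
        · exact ⟨z, by simp, zu', πu'⟩
      · intro p hp q hq hpq j hj
        simp only [Finset.mem_insert, Finset.mem_singleton] at hp hq
        rcases hp with rfl | rfl | rfl <;> rcases hq with rfl | rfl | rfl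
        · exact absurd rfl hpq
        · exact (s1 j hj).1
        · exact (s2 j hj).1
        · exact (s1 j hj).2
        · exact absurd rfl hpq
        · exact (s3 j hj).1
        · exact (s2 j hj).2
        · exact (s3 j hj).2
        · exact absurd rfl hpq
      · intro p hp
        simp only [Finset.mem_insert, Finset.mem_singleton] at hp
        rcases hp with rfl | rfl | rfl
        · exact fun h => hz (hWΦ h)
        · exact fun h => hu (hWΦ h)
        · exact fun h => hu' (hWΦ h)
    have hlt : (Finset.univ.filter fun v => v ∉ Φ ∧ ¬ D v (π v)).card
        < (Finset.univ.filter fun v => v ∉ Φ ∧ ¬ D v (σ v)).card := by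
      apply Finset.card_lt_card
      rw [Finset.ssubset_iff_of_subset]
      · refine ⟨z, by simp [hz, hDz], ?_⟩
        simp [πz, d1]
      · intro v
        simp only [Finset.mem_filter, Finset.mem_univ, true_and]
        rintro ⟨hv, hD⟩
        refine ⟨hv, ?_⟩
        rwa [πne v] at hD
        · rintro rfl; exact hD (πz ▸ d1)
        · rintro rfl; exact hD (πu ▸ d2)
        · rintro rfl; exact hD (πu' ▸ d3)
    obtain ⟨τ, t1, t2, t3, t4⟩ := ih π πg (by omega)
    refine ⟨τ, fun v hv => (t1 v hv).trans (πΦ v hv), t2, t3, ?_⟩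
    have : (Finset.univ.filter fun v => τ v ≠ σ v) ⊆
        (Finset.univ.filter fun v => τ v ≠ π v) ∪ {z, u, u'} := by
      intro v
      simp only [Finset.mem_filter, Finset.mem_univ, true_and, Finset.mem_union,
        Finset.mem_insert, Finset.mem_singleton]
      intro hv
      by_contra hcon
      push Not at hcon
      obtain ⟨h1, h2, h3, h4⟩ := hcon
      exact hv (h1.trans (πne v h2 h3 h4))
    have h2 := Finset.card_le_card this
    have h3 := Finset.card_union_le (Finset.univ.filter fun v => τ v ≠ π v) {z, u, u'}
    have h4 : ({z, u, u'} : Finset V).card ≤ 3 := Finset.card_le_three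
    omega

theorem ManyEdges.card_avoid [Fintype V] {D : V → V → Prop} {δ E : ℕ} (hE : ManyEdges D δ E)
    (U S T : Finset V) (hS : δ ≤ S.card) (hT : δ ≤ T.card) :
    E ≤ ((S ×ˢ T).filter fun p => D p.1 p.2 ∧ p.1 ∉ U ∧ p.2 ∉ U).card +
      2 * U.card * Fintype.card V := by
  have h : ((S ×ˢ T).filter fun p => D p.1 p.2) ⊆
      ((S ×ˢ T).filter fun p => D p.1 p.2 ∧ p.1 ∉ U ∧ p.2 ∉ U) ∪
        ((U ×ˢ Finset.univ) ∪ (Finset.univ ×ˢ U)) := by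
    intro p
    simp only [Finset.mem_filter, Finset.mem_union, Finset.mem_product, Finset.mem_univ]
    tauto
  have h1 := (hE S T hS hT).trans (Finset.card_le_card h)
  have h2 := Finset.card_union_le ((S ×ˢ T).filter fun p => D p.1 p.2 ∧ p.1 ∉ U ∧ p.2 ∉ U)
    ((U ×ˢ Finset.univ) ∪ (Finset.univ ×ˢ U))
  have h3 := Finset.card_union_le (U ×ˢ (Finset.univ : Finset V)) (Finset.univ ×ˢ U)
  simp only [Finset.card_product, Finset.card_univ] at h3
  nlinarith

theorem exists_heavy_edge [Fintype V] (D : V → V → Prop) (δ E : ℕ)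
    (hout : ∀ v, δ ≤ (Finset.univ.filter fun u => D v u).card)
    (hin : ∀ v, δ ≤ (Finset.univ.filter fun u => D u v).card)
    (hE : ManyEdges D δ E) (U : Finset V) (hU : 2 * (2 * U.card * Fintype.card V) < E)
    (wt : V × V → ℝ) (hwt : ∀ p, 0 < wt p) (hV : 0 < Fintype.card V) :
    ∃ w w', D w w' ∧ w ∉ U ∧ w' ∉ U ∧
      (E : ℝ) / 2 * ∑ p, wt p ≤ (Fintype.card V : ℝ) ^ 2 *
        ∑ p ∈ Finset.univ.filter (fun p : V × V => D p.1 w ∧ D w' p.2), wt p := by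
  set F : V × V → ℝ := fun e => if D e.1 e.2 ∧ e.1 ∉ U ∧ e.2 ∉ U then
    ∑ p ∈ Finset.univ.filter (fun p : V × V => D p.1 e.1 ∧ D e.2 p.2), wt p else 0 with hF
  have : Nonempty V := Fintype.card_pos_iff.1 hV
  have hpos : 0 < ∑ p, wt p := Finset.sum_pos (fun p _ => hwt p) Finset.univ_nonempty
  have hsum : (E : ℝ) / 2 * ∑ p, wt p ≤ ∑ e, F e := by
    have e1 : ∀ e, F e = ∑ p, if D e.1 e.2 ∧ e.1 ∉ U ∧ e.2 ∉ U ∧ D p.1 e.1 ∧ D e.2 p.2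
        then wt p else 0 := by
      intro e
      simp only [hF]
      split_ifs with h
      · rw [Finset.sum_filter]
        refine Finset.sum_congr rfl fun p _ => ?_
        simp [h]
      · symm
        refine Finset.sum_eq_zero fun p _ => if_neg fun h' => h ⟨h'.1, h'.2.1, h'.2.2.1⟩
    simp only [e1]
    rw [Finset.sum_comm, Finset.mul_sum]
    refine Finset.sum_le_sum fun p _ => ?_
    rw [← Finset.sum_filter, Finset.sum_const, nsmul_eq_mul]
    refine mul_le_mul_of_nonneg_right ?_ (hwt p).le
    have h := hE.card_avoid U (Finset.univ.filter fun u => D p.1 u)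
      (Finset.univ.filter fun u => D u p.2) (hout _) (hin _)
    have h2 : (((Finset.univ.filter fun u => D p.1 u) ×ˢ
        (Finset.univ.filter fun u => D u p.2)).filter
        fun p => D p.1 p.2 ∧ p.1 ∉ U ∧ p.2 ∉ U) ⊆
        Finset.univ.filter fun e : V × V =>
          D e.1 e.2 ∧ e.1 ∉ U ∧ e.2 ∉ U ∧ D p.1 e.1 ∧ D e.2 p.2 := by
      intro e
      simp only [Finset.mem_filter, Finset.mem_product, Finset.mem_univ, true_and]
      tauto
    have h3 := Finset.card_le_card h2
    have h4 : E ≤ 2 * (Finset.univ.filter fun e : V × V =>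
          D e.1 e.2 ∧ e.1 ∉ U ∧ e.2 ∉ U ∧ D p.1 e.1 ∧ D e.2 p.2).card := by omega
    have h5 : (E : ℝ) ≤ 2 * ((Finset.univ.filter fun e : V × V =>
          D e.1 e.2 ∧ e.1 ∉ U ∧ e.2 ∉ U ∧ D p.1 e.1 ∧ D e.2 p.2).card : ℝ) := by exact_mod_cast h4
    linarith
  have hcard : (0 : ℝ) < (Fintype.card V : ℝ) ^ 2 := by positivity
  obtain ⟨e, -, he⟩ := Finset.exists_le_of_sum_le (s := (Finset.univ : Finset (V × V)))
    (f := fun _ => ((E : ℝ) / 2 * ∑ p, wt p) / (Fintype.card V : ℝ) ^ 2) (g := F)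
    Finset.univ_nonempty (by
      rw [Finset.sum_const, Finset.card_univ, Fintype.card_prod, nsmul_eq_mul]
      refine le_trans (le_of_eq ?_) hsum
      push_cast
      field_simp)
  have hE0 : 0 < (E : ℝ) := by exact_mod_cast (by omega : 0 < E)
  have hFe : 0 < F e := lt_of_lt_of_le (by positivity) he
  have hgood : D e.1 e.2 ∧ e.1 ∉ U ∧ e.2 ∉ U := by
    by_contra h
    simp only [hF, if_neg h] at hFe
    exact lt_irrefl _ hFe
  refine ⟨e.1, e.2, hgood.1, hgood.2.1, hgood.2.2, ?_⟩
  rw [div_le_iff₀ hcard] at he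
  simp only [hF, if_pos hgood] at he
  linarith

/-- A family of vertex-disjoint paths `q j 0 → q j 1 → q j 2 → q j 3` with a chord
`q j 0 → q j 3`, for `j < s`. -/
structure IsGadgetFamily (D : V → V → Prop) (s : ℕ) (q : ℕ → Fin 4 → V) : Prop where
  inj : ∀ i < s, ∀ j < s, ∀ k l, q i k = q j l → i = j ∧ k = l
  e01 : ∀ j < s, D (q j 0) (q j 1)
  e12 : ∀ j < s, D (q j 1) (q j 2)
  e23 : ∀ j < s, D (q j 2) (q j 3)
  e03 : ∀ j < s, D (q j 0) (q j 3)

theorem injective_vec_four {a b c d : V} (hab : a ≠ b) (hac : a ≠ c) (had : a ≠ d) (hbc : b ≠ c)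
    (hbd : b ≠ d) (hcd : c ≠ d) : Function.Injective ![a, b, c, d] := by
  intro k l h
  fin_cases k <;> fin_cases l <;>
    first
    | rfl
    | exact absurd h hab
    | exact absurd h hac
    | exact absurd h had
    | exact absurd h hbc
    | exact absurd h hbd
    | exact absurd h hcd
    | exact absurd h.symm hab
    | exact absurd h.symm hac
    | exact absurd h.symm had
    | exact absurd h.symm hbc
    | exact absurd h.symm hbd
    | exact absurd h.symm hcd

theorem IsGadgetFamily.extend {D : V → V → Prop} {r : ℕ} {q q' : ℕ → Fin 4 → V}
    (hq : IsGadgetFamily D r q) (hqq : ∀ j < r, q' j = q j)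
    (hinj : Function.Injective (q' r)) (hnew : ∀ j < r, ∀ k l, q j k ≠ q' r l)
    (h01 : D (q' r 0) (q' r 1)) (h12 : D (q' r 1) (q' r 2)) (h23 : D (q' r 2) (q' r 3))
    (h03 : D (q' r 0) (q' r 3)) : IsGadgetFamily D (r + 1) q' := by
  refine ⟨?_, ?_, ?_, ?_, ?_⟩
  · intro i hi j hj k l h
    rcases Nat.lt_succ_iff_lt_or_eq.1 hi with hi | rfl <;>
    rcases Nat.lt_succ_iff_lt_or_eq.1 hj with hj | rfl
    · rw [hqq i hi, hqq j hj] at h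
      exact hq.inj i hi j hj k l h
    · rw [hqq i hi] at h
      exact absurd h (hnew i hi k l)
    · rw [hqq j hj] at h
      exact absurd h.symm (hnew j hj l k)
    · exact ⟨rfl, hinj h⟩
  all_goals
    intro j hj
    rcases Nat.lt_succ_iff_lt_or_eq.1 hj with hj | rfl
  · rw [hqq j hj]; exact hq.e01 j hj
  · exact h01
  · rw [hqq j hj]; exact hq.e12 j hj
  · exact h12
  · rw [hqq j hj]; exact hq.e23 j hj
  · exact h23
  · rw [hqq j hj]; exact hq.e03 j hj
  · exact h03

theorem exists_gadgets_weight [Fintype V] (D : V → V → Prop) (hirr : ∀ v, ¬ D v v) (δ E s : ℕ)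
    (hout : ∀ v, δ ≤ (Finset.univ.filter fun u => D v u).card)
    (hin : ∀ v, δ ≤ (Finset.univ.filter fun u => D u v).card)
    (hE : ManyEdges D δ E) (hs : (16 * s + 16) * Fintype.card V ≤ E)
    (hV : 0 < Fintype.card V) (r : ℕ) (hr : r ≤ s) :
    ∃ q : ℕ → Fin 4 → V, IsGadgetFamily D r q ∧
      ∑ p : V × V, (1 / 2 : ℝ) ^
        ((Finset.range r).filter fun j => D p.1 (q j 1) ∧ D (q j 2) p.2).card ≤
      (Fintype.card V : ℝ) ^ 2 * (1 - E / (4 * (Fintype.card V : ℝ) ^ 2)) ^ r := by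
  induction r with
  | zero =>
    have : Nonempty V := Fintype.card_pos_iff.1 hV
    refine ⟨fun _ _ => Classical.arbitrary V, ⟨?_, ?_, ?_, ?_, ?_⟩, ?_⟩
    · intro i hi; omega
    · intro i hi; omega
    · intro i hi; omega
    · intro i hi; omega
    · intro i hi; omega
    · simp [sq]
  | succ r ih =>
    obtain ⟨q, hq, hsum⟩ := ih (by omega)
    set n := Fintype.card V with hn
    set U : Finset V := (Finset.range r ×ˢ Finset.univ).image fun p : ℕ × Fin 4 => q p.1 p.2
      with hU
    have hUc : U.card ≤ 4 * r := by
      refine Finset.card_image_le.trans ?_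
      simp [mul_comm]
    have hUm : ∀ v, v ∉ U → ∀ j < r, ∀ k, q j k ≠ v := by
      intro v hv j hj k h
      exact hv (Finset.mem_image.2 ⟨(j, k), by simp [hj], h⟩)
    set wt : V × V → ℝ := fun p => (1 / 2 : ℝ) ^
        ((Finset.range r).filter fun j => D p.1 (q j 1) ∧ D (q j 2) p.2).card with hwt
    have hUn : U.card * n ≤ 4 * r * n := Nat.mul_le_mul_right _ hUc
    have hrn : r * n + n ≤ s * n := by
      have := Nat.mul_le_mul_right n hr
      linarith
    obtain ⟨w, w', hw, hwU, hwU', hheavy⟩ := exists_heavy_edge D δ E hout hin hE U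
      (by nlinarith) wt (fun p => by positivity) hV
    have hww' : w ≠ w' := fun h => hirr w (by rw [← h] at hw; exact hw)
    have hav := hE.card_avoid (insert w (insert w' U)) (Finset.univ.filter fun u => D u w)
      (Finset.univ.filter fun u => D w' u) (hin _) (hout _)
    have hic : (insert w (insert w' U)).card ≤ U.card + 2 := by
      refine (Finset.card_insert_le _ _).trans ?_
      have := Finset.card_insert_le w' U
      omega
    have hicn := Nat.mul_le_mul_right n hic
    have hpos : 0 < (((Finset.univ.filter fun u => D u w) ×ˢ
        (Finset.univ.filter fun u => D w' u)).filter fun p => D p.1 p.2 ∧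
          p.1 ∉ insert w (insert w' U) ∧ p.2 ∉ insert w (insert w' U)).card := by
      by_contra h0
      have : (((Finset.univ.filter fun u => D u w) ×ˢ
        (Finset.univ.filter fun u => D w' u)).filter fun p => D p.1 p.2 ∧
          p.1 ∉ insert w (insert w' U) ∧ p.2 ∉ insert w (insert w' U)).card = 0 := by omega
      rw [this] at hav
      nlinarith
    obtain ⟨⟨a, b⟩, hab⟩ := Finset.card_pos.1 hpos
    simp only [Finset.mem_filter, Finset.mem_product, Finset.mem_univ, true_and,
      Finset.mem_insert, not_or] at hab
    obtain ⟨⟨haw, hwb⟩, hDab, ⟨a1, a2, a3⟩, b1, b2, b3⟩ := hab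
    have hab : a ≠ b := fun h => hirr a (by rw [← h] at hDab; exact hDab)
    set q' : ℕ → Fin 4 → V := fun j => if j = r then ![a, w, w', b] else q j with hq'
    have q'r : q' r = ![a, w, w', b] := by simp [hq']
    have q'j : ∀ j < r, q' j = q j := fun j hj => by simp [hq', hj.ne]
    have hnew : ∀ k, q' r k ∉ U := by
      rw [q'r]; intro k; fin_cases k <;> simp [a3, hwU, hwU', b3]
    refine ⟨q', hq.extend q'j ?_ (fun j hj k l => hUm _ (hnew l) j hj k) ?_ ?_ ?_ ?_, ?_⟩
    · rw [q'r]
      exact injective_vec_four a1 a2 hab hww' (Ne.symm b1) (Ne.symm b2)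
    · rw [q'r]; exact haw
    · rw [q'r]; exact hw
    · rw [q'r]; exact hwb
    · rw [q'r]; exact hDab
    · have hn0 : (0 : ℝ) < (n : ℝ) ^ 2 := by
        have : (0 : ℝ) < n := by exact_mod_cast hV
        positivity
      have hterm : ∀ p : V × V, (1 / 2 : ℝ) ^
          ((Finset.range (r + 1)).filter fun j => D p.1 (q' j 1) ∧ D (q' j 2) p.2).card =
          wt p - 1 / 2 * (if D p.1 w ∧ D w' p.2 then wt p else 0) := by
        intro p
        have hf : ((Finset.range r).filter fun j => D p.1 (q' j 1) ∧ D (q' j 2) p.2) =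
            ((Finset.range r).filter fun j => D p.1 (q j 1) ∧ D (q j 2) p.2) := by
          refine Finset.filter_congr fun j hj => ?_
          rw [q'j j (Finset.mem_range.1 hj)]
        have e1 : q' r 1 = w := by rw [q'r]; rfl
        have e2 : q' r 2 = w' := by rw [q'r]; rfl
        rw [Finset.range_add_one, Finset.filter_insert, hf, e1, e2]
        split_ifs with h
        · rw [Finset.card_insert_of_notMem (by simp), pow_succ]
          simp only [hwt]; ring
        · simp [hwt]
      rw [Finset.sum_congr rfl fun p _ => hterm p, Finset.sum_sub_distrib, ← Finset.mul_sum,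
        ← Finset.sum_filter]
      have hle : (E : ℝ) / (4 * (n : ℝ) ^ 2) ≤ 1 := by
        have h1 := hE Finset.univ Finset.univ
          ((hout (Classical.choice (Fintype.card_pos_iff.1 hV))).trans (Finset.card_filter_le _ _))
          ((hout (Classical.choice (Fintype.card_pos_iff.1 hV))).trans (Finset.card_filter_le _ _))
        have h2 : E ≤ n * n := by
          refine h1.trans ((Finset.card_filter_le _ _).trans ?_)
          simp [hn]
        have h3 : (E : ℝ) ≤ (n : ℝ) * n := by exact_mod_cast h2
        rw [div_le_one (by positivity)]
        nlinarith
      have h1 : ∑ p, wt p - 1 / 2 * ∑ p ∈ Finset.univ.filter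
          (fun p : V × V => D p.1 w ∧ D w' p.2), wt p ≤
          (∑ p, wt p) * (1 - E / (4 * (n : ℝ) ^ 2)) := by
        have : (∑ p, wt p) * (E / (4 * (n : ℝ) ^ 2)) ≤ 1 / 2 * ∑ p ∈ Finset.univ.filter
          (fun p : V × V => D p.1 w ∧ D w' p.2), wt p := by
          rw [mul_div_assoc', div_le_iff₀ (by positivity)]
          nlinarith
        linarith
      refine h1.trans ?_
      rw [pow_succ _ r, ← mul_assoc]
      exact mul_le_mul_of_nonneg_right hsum (sub_nonneg.2 hle)

theorem exists_gadgets [Fintype V] (D : V → V → Prop) (hirr : ∀ v, ¬ D v v) (δ E s K : ℕ)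
    (hout : ∀ v, δ ≤ (Finset.univ.filter fun u => D v u).card)
    (hin : ∀ v, δ ≤ (Finset.univ.filter fun u => D u v).card)
    (hE : ManyEdges D δ E) (hs : (16 * s + 16) * Fintype.card V ≤ E)
    (hV : 0 < Fintype.card V)
    (hK : (Fintype.card V : ℝ) ^ 2 * (1 - E / (4 * (Fintype.card V : ℝ) ^ 2)) ^ s <
      (1 / 2 : ℝ) ^ K) :
    ∃ q : ℕ → Fin 4 → V, IsGadgetFamily D s q ∧
      ∀ x y, K ≤ ((Finset.range s).filter fun j => D x (q j 1) ∧ D (q j 2) y).card := by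
  obtain ⟨q, hq, hsum⟩ := exists_gadgets_weight D hirr δ E s hout hin hE hs hV s le_rfl
  refine ⟨q, hq, fun x y => ?_⟩
  have h1 := Finset.single_le_sum (s := (Finset.univ : Finset (V × V))) (f := fun p : V × V =>
    (1 / 2 : ℝ) ^ ((Finset.range s).filter fun j => D p.1 (q j 1) ∧ D (q j 2) p.2).card)
    (fun p _ => by positivity) (Finset.mem_univ (x, y))
  have h2 := lt_of_le_of_lt (h1.trans hsum) hK
  exact ((pow_lt_pow_iff_right_of_lt_one₀ (by norm_num) (by norm_num)).1 h2).le

theorem exists_transversal (r : V → V → Prop) (hsymm : ∀ u v, r u v → r v u)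
    (hrefl : ∀ u, r u u) (S : Finset V) :
    ∃ R ⊆ S, (∀ u ∈ R, ∀ v ∈ R, r u v → u = v) ∧ ∀ v ∈ S, ∃ u ∈ R, r u v := by
  induction S using Finset.induction_on with
  | empty => exact ⟨∅, by simp⟩
  | insert a S _ ih =>
    obtain ⟨R, hRS, h1, h2⟩ := ih
    by_cases h : ∃ u ∈ R, r u a
    · refine ⟨R, hRS.trans (Finset.subset_insert _ _), h1, fun v hv => ?_⟩
      rcases Finset.mem_insert.1 hv with rfl | hv
      · exact h
      · exact h2 v hv
    · push Not at h
      refine ⟨insert a R, Finset.insert_subset_insert _ hRS, ?_, fun v hv => ?_⟩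
      · intro u hu v hv huv
        rcases Finset.mem_insert.1 hu with rfl | hu' <;>
          rcases Finset.mem_insert.1 hv with rfl | hv'
        · rfl
        · exact absurd (hsymm _ _ huv) (h v hv')
        · exact absurd huv (h u hu')
        · exact h1 u hu' v hv' huv
      · rcases Finset.mem_insert.1 hv with rfl | hv
        · exact ⟨v, Finset.mem_insert_self _ _, hrefl v⟩
        · obtain ⟨u, hu, huv⟩ := h2 v hv
          exact ⟨u, Finset.mem_insert_of_mem hu, huv⟩

theorem card_mul_le_of_girth [Fintype V] (σ : Equiv.Perm V) (g : ℕ) (R : Finset V)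
    (hR : ∀ u ∈ R, ∀ v ∈ R, σ.SameCycle u v → u = v)
    (hg : ∀ v ∈ R, ∀ i, 1 ≤ i → i < g → (σ ^ i) v ≠ v) : R.card * g ≤ Fintype.card V := by
  rw [← Finset.card_range g, ← Finset.card_product, ← Finset.card_univ]
  refine Finset.card_le_card_of_injOn (fun p => (σ ^ p.2) p.1) (fun _ _ => Finset.mem_univ _) ?_
  have key : ∀ v ∈ R, ∀ i j, i < j → j < g → (σ ^ i) v ≠ (σ ^ j) v := by
    intro v hv i j hij hj h
    refine hg v hv (j - i) (by omega) (by omega) ?_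
    apply (σ ^ i).injective
    rw [← Equiv.Perm.mul_apply, ← pow_add, Nat.add_sub_cancel' hij.le, h]
  rintro ⟨u, i⟩ hu ⟨v, j⟩ hv h
  simp only [Finset.coe_product, Set.mem_prod, Finset.mem_coe, Finset.mem_range] at hu hv h
  have huv : u = v := by
    refine hR u hu.1 v hv.1 ?_
    rw [← Equiv.Perm.sameCycle_pow_left (n := i), ← Equiv.Perm.sameCycle_pow_right (n := j), h]
  subst huv
  rcases lt_trichotomy i j with hij | rfl | hij
  · exact absurd h (key u hu.1 i j hij hv.2)
  · rfl
  · exact absurd h.symm (key u hu.1 j i hij hu.2)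

theorem exists_hamilton_of_girth [Fintype V] (D : V → V → Prop) (s g K : ℕ) (q : ℕ → Fin 4 → V)
    (hq : IsGadgetFamily D s q) (σ : Equiv.Perm V) (hg0 : 0 < g)
    (hfix : ∀ j < s, σ (q j 1) = q j 1 ∧ σ (q j 2) = q j 2)
    (ha : ∀ j < s, σ (q j 0) = q j 3)
    (hD : ∀ v, (∀ j < s, v ≠ q j 0 ∧ v ≠ q j 1 ∧ v ≠ q j 2) → D v (σ v))
    (hg : ∀ v, (∀ j < s, v ≠ q j 1 ∧ v ≠ q j 2) → ∀ i, 1 ≤ i → i < g → (σ ^ i) v ≠ v)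
    (hn : Fintype.card V ≤ K * g)
    (hK : ∀ x y, K ≤ ((Finset.range s).filter fun j => D x (q j 1) ∧ D (q j 2) y).card) :
    ∃ τ : Equiv.Perm V, IsHamCycle D τ ∧
      (Finset.univ.filter fun v => τ v ≠ σ v).card ≤ K + 3 * s := by
  have qne : ∀ i < s, ∀ j < s, ∀ k l, k ≠ l → q i k ≠ q j l := fun i hi j hj k l hkl h =>
    hkl (hq.inj i hi j hj k l h).2
  have qin : ∀ k, ∀ i < s, ∀ j < s, q i k = q j k → i = j := fun k i hi j hj h =>
    (hq.inj i hi j hj k k h).1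
  set S : Finset V := Finset.univ.filter fun v => ∀ j < s, v ≠ q j 0 ∧ v ≠ q j 1 ∧ v ≠ q j 2
    with hS
  obtain ⟨R, hRS, hR1, hR2⟩ := exists_transversal (fun u v => σ.SameCycle u v)
    (fun _ _ h => h.symm) (fun _ => Equiv.Perm.SameCycle.refl _ _) S
  have hRm : ∀ r ∈ R, ∀ j < s, r ≠ q j 0 ∧ r ≠ q j 1 ∧ r ≠ q j 2 := fun r hr =>
    (Finset.mem_filter.1 (hRS hr)).2
  have hRK : R.card ≤ K := by
    refine Nat.le_of_mul_le_mul_right ((card_mul_le_of_girth σ g R hR1 ?_).trans hn) hg0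
    exact fun v hv => hg v fun j hj => (hRm v hv j hj).2
  obtain ⟨ρ, hρ1, hρ2, hρ3⟩ := exists_perm_unite σ R
  have hρR : ∀ v, (∀ j < s, v ≠ q j 1 ∧ v ≠ q j 2) → ∃ r ∈ R, ρ.SameCycle r v := by
    intro v hv
    by_cases hvS : v ∈ S
    · obtain ⟨r, hr, h⟩ := hR2 v hvS
      exact ⟨r, hr, hρ2 _ _ h⟩
    · simp only [hS, Finset.mem_filter, Finset.mem_univ, true_and] at hvS
      push Not at hvS
      obtain ⟨j, hj, h⟩ := hvS
      have hva : v = q j 0 := by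
        by_contra hne
        exact (hv j hj).2 (h hne (hv j hj).1)
      have hb : q j 3 ∈ S := by
        simp only [hS, Finset.mem_filter, Finset.mem_univ, true_and]
        exact fun i hi => ⟨qne j hj i hi _ _ (by decide), qne j hj i hi _ _ (by decide),
          qne j hj i hi _ _ (by decide)⟩
      obtain ⟨r, hr, h⟩ := hR2 _ hb
      refine ⟨r, hr, hρ2 _ _ (h.trans ?_)⟩
      rw [hva, ← ha j hj]
      exact Equiv.Perm.SameCycle.symm ⟨1, by simp⟩
  have hρa : ∀ j < s, ρ (q j 0) = q j 3 := fun j hj => by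
    rw [hρ1 _ fun h => (hRm _ h j hj).1 rfl, ha j hj]
  have hρw : ∀ j < s, ρ (q j 1) = q j 1 := fun j hj => by
    rw [hρ1 _ fun h => (hRm _ h j hj).2.1 rfl, (hfix j hj).1]
  have hρw' : ∀ j < s, ρ (q j 2) = q j 2 := fun j hj => by
    rw [hρ1 _ fun h => (hRm _ h j hj).2.2 rfl, (hfix j hj).2]
  obtain ⟨f, hf1, hf2⟩ := (Finset.all_card_le_biUnion_card_iff_exists_injective
    (fun r : R => (Finset.range s).filter fun j => D r.1 (q j 1) ∧ D (q j 2) (ρ r.1))).1 (by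
      intro T
      obtain rfl | ⟨r, hr⟩ := T.eq_empty_or_nonempty
      · simp
      · have h1 : T.card ≤ R.card := by
          refine T.card_le_univ.trans ?_
          simp
        refine h1.trans (hRK.trans ((hK r.1 (ρ r.1)).trans ?_))
        exact Finset.card_le_card (Finset.subset_biUnion_of_mem (fun r : R =>
          (Finset.range s).filter fun j => D r.1 (q j 1) ∧ D (q j 2) (ρ r.1)) hr))
  simp only [Finset.mem_filter, Finset.mem_range] at hf2
  obtain ⟨p, hp1, hp2⟩ : ∃ p : ℕ → V, (∀ r : R, p (f r) = r) ∧
      ∀ j, (∀ r, f r ≠ j) → p j = q j 0 := by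
    refine ⟨fun j => if h : ∃ r, f r = j then (h.choose : R).1 else q j 0, fun r => ?_,
      fun j hj => ?_⟩
    · have h : ∃ r', f r' = f r := ⟨r, rfl⟩
      simp only [dif_pos h]
      exact congrArg _ (hf1 h.choose_spec)
    · exact dif_neg (by simpa using hj)
  have pcases : ∀ j, (∃ r : R, f r = j ∧ p j = r) ∨ ((∀ r, f r ≠ j) ∧ p j = q j 0) := by
    intro j
    by_cases h : ∃ r, f r = j
    · obtain ⟨r, rfl⟩ := h
      exact Or.inl ⟨r, rfl, hp1 r⟩
    · push Not at h
      exact Or.inr ⟨h, hp2 j h⟩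
  have pw : ∀ i < s, ∀ j < s, p i ≠ q j 1 ∧ p i ≠ q j 2 := by
    intro i hi j hj
    rcases pcases i with ⟨r, -, h⟩ | ⟨-, h⟩ <;> rw [h]
    · exact (hRm r r.2 j hj).2
    · exact ⟨qne i hi j hj _ _ (by decide), qne i hi j hj _ _ (by decide)⟩
  obtain ⟨τ, t1, t2, t3⟩ := exists_perm_insert ρ p (fun j => q j 1) (fun j => q j 2)
    (Finset.range s)
    (by
      intro i hi j hj h
      rw [Finset.mem_range] at hi hj
      rcases pcases i with ⟨r, hr, h1⟩ | ⟨-, h1⟩ <;> rcases pcases j with ⟨r', hr', h2⟩ | ⟨-, h2⟩ <;>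
        rw [h1, h2] at h
      · rw [← hr, ← hr', Subtype.ext h]
      · exact absurd h (hRm r r.2 j hj).1
      · exact absurd h.symm (hRm r' r'.2 i hi).1
      · exact qin 0 i hi j hj h)
    (by simpa using qin 1) (by simpa using qin 2)
    (by
      intro i hi j hj
      rw [Finset.mem_range] at hi hj
      exact qne i hi j hj _ _ (by decide))
    (fun i hi j hj => (pw i (Finset.mem_range.1 hi) j (Finset.mem_range.1 hj)).1)
    (fun i hi j hj => (pw i (Finset.mem_range.1 hi) j (Finset.mem_range.1 hj)).2)
    (fun j hj => hρw j (Finset.mem_range.1 hj)) (fun j hj => hρw' j (Finset.mem_range.1 hj))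
  simp only [Finset.mem_range] at t1 t2
  have hstep : ∀ v, τ.SameCycle v (τ v) := fun v => ⟨1, by simp⟩
  refine ⟨τ, ⟨fun v => ?_, ?_⟩, ?_⟩
  · by_cases h1 : ∃ j < s, v = q j 1
    · obtain ⟨j, hj, rfl⟩ := h1
      rw [(t1 j hj).2.1]
      exact hq.e12 j hj
    by_cases h2 : ∃ j < s, v = q j 2
    · obtain ⟨j, hj, rfl⟩ := h2
      rw [(t1 j hj).2.2]
      rcases pcases j with ⟨r, hr, h⟩ | ⟨-, h⟩ <;> rw [h]
      · subst hr
        exact (hf2 r).2.2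
      · rw [hρa j hj]
        exact hq.e23 j hj
    by_cases h3 : ∃ j < s, v = p j
    · obtain ⟨j, hj, rfl⟩ := h3
      rw [(t1 j hj).1]
      rcases pcases j with ⟨r, hr, h⟩ | ⟨-, h⟩ <;> rw [h]
      · subst hr
        exact (hf2 r).2.1
      · exact hq.e01 j hj
    push Not at h1 h2 h3
    rw [t2 v fun j hj => ⟨h3 j hj, h1 j hj, h2 j hj⟩]
    by_cases h4 : ∃ j < s, v = q j 0
    · obtain ⟨j, hj, rfl⟩ := h4
      rw [hρa j hj]
      exact hq.e03 j hj
    push Not at h4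
    have hvR : v ∉ R := fun hv => h3 _ (hf2 ⟨v, hv⟩).1 (hp1 ⟨v, hv⟩).symm
    rw [hρ1 v hvR]
    exact hD v fun j hj => ⟨h4 j hj, h1 j hj, h2 j hj⟩
  · have key : ∀ v, ∃ r ∈ R, τ.SameCycle r v := by
      have k0 : ∀ v, (∀ j < s, v ≠ q j 1 ∧ v ≠ q j 2) → ∃ r ∈ R, τ.SameCycle r v := by
        intro v hv
        obtain ⟨r, hr, h⟩ := hρR v hv
        exact ⟨r, hr, t3 _ _ h⟩
      have k1 : ∀ j < s, ∃ r ∈ R, τ.SameCycle r (q j 1) := by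
        intro j hj
        obtain ⟨r, hr, h⟩ := k0 (p j) (pw j hj)
        refine ⟨r, hr, h.trans ?_⟩
        have := hstep (p j)
        rwa [(t1 j hj).1] at this
      intro v
      by_cases h1 : ∃ j < s, v = q j 1
      · obtain ⟨j, hj, rfl⟩ := h1
        exact k1 j hj
      by_cases h2 : ∃ j < s, v = q j 2
      · obtain ⟨j, hj, rfl⟩ := h2
        obtain ⟨r, hr, h⟩ := k1 j hj
        refine ⟨r, hr, h.trans ?_⟩
        have := hstep (q j 1)
        rwa [(t1 j hj).2.1] at this
      push Not at h1 h2
      exact k0 v fun j hj => ⟨h1 j hj, h2 j hj⟩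
    intro v w
    obtain ⟨r, hr, h⟩ := key v
    obtain ⟨r', hr', h'⟩ := key w
    exact (h.symm.trans (t3 _ _ (hρ3 r hr r' hr'))).trans h'
  · have hsub : (Finset.univ.filter fun v => τ v ≠ σ v) ⊆ R ∪ ((Finset.range s).image p ∪
        ((Finset.range s).image (fun j => q j 1) ∪ (Finset.range s).image fun j => q j 2)) := by
      intro v hv
      by_contra h
      simp only [Finset.mem_union, Finset.mem_image, Finset.mem_range, not_or, not_exists,
        not_and] at h
      obtain ⟨h0, h1, h2, h3⟩ := h
      refine (Finset.mem_filter.1 hv).2 ?_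
      rw [t2 v fun j hj => ⟨Ne.symm (h1 j hj), Ne.symm (h2 j hj), Ne.symm (h3 j hj)⟩, hρ1 v h0]
    have c1 := Finset.card_le_card hsub
    have c2 := Finset.card_union_le R ((Finset.range s).image p ∪
        ((Finset.range s).image (fun j => q j 1) ∪ (Finset.range s).image fun j => q j 2))
    have c3 := Finset.card_union_le ((Finset.range s).image p)
        ((Finset.range s).image (fun j => q j 1) ∪ (Finset.range s).image fun j => q j 2)
    have c4 := Finset.card_union_le ((Finset.range s).image (fun j => q j 1))
      ((Finset.range s).image fun j => q j 2)
    have c5 := Finset.card_image_le (s := Finset.range s) (f := p)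
    have c6 := Finset.card_image_le (s := Finset.range s) (f := fun j => q j 1)
    have c7 := Finset.card_image_le (s := Finset.range s) (f := fun j => q j 2)
    rw [Finset.card_range] at c5 c6 c7
    omega

theorem exists_perm_extend [Fintype V] (S : Finset V) (e : V → V) (he : Set.InjOn e S) :
    ∃ σ : Equiv.Perm V, ∀ v ∈ S, σ v = e v := by
  obtain ⟨g, hg⟩ := Finset.exists_equiv_extend_of_card_eq (t := (Finset.univ : Finset V))
    (s := S) (f := e) Finset.card_univ.symm (Finset.subset_univ _) he
  refine ⟨Equiv.ofBijective (fun v => (g v : V)) ?_, hg⟩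
  exact Finite.injective_iff_bijective.1 fun a b h => g.injective (Subtype.ext h)

theorem girth_of_sameCycle [Fintype V] (τ : Equiv.Perm V) (S : Finset V) (g : ℕ)
    (hS : ∀ u ∈ S, ∀ v ∈ S, τ.SameCycle u v) (hg : g ≤ S.card) :
    ∀ v ∈ S, ∀ i, 1 ≤ i → i < g → (τ ^ i) v ≠ v := by
  intro v hv i hi hig h
  have hsub : S ⊆ (Finset.range i).image fun j => (τ ^ j) v := by
    intro u hu
    obtain ⟨j, -, hj⟩ := (hS v hv u hu).exists_pow_eq''
    refine Finset.mem_image.2 ⟨j % i, Finset.mem_range.2 (Nat.mod_lt _ hi), ?_⟩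
    have hper : ∀ l : ℕ, (τ ^ (i * l)) v = v := by
      intro l
      induction l with
      | zero => simp
      | succ l ih => rw [mul_add, mul_one, pow_add, Equiv.Perm.mul_apply, h, ih]
    rw [← hj.2]
    conv_rhs => rw [← Nat.mod_add_div j i, pow_add, Equiv.Perm.mul_apply, hper]
  have := (Finset.card_le_card hsub).trans Finset.card_image_le
  rw [Finset.card_range] at this
  omega

theorem exists_perm_init [Fintype V] {D : V → V → Prop} {s : ℕ} {q : ℕ → Fin 4 → V}
    (hq : IsGadgetFamily D s q) (L : V → V → Prop) {k : ℕ} [NeZero k] (f : V → ZMod k)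
    (c : ZMod k) (M : Finset V) (m : V → V) (hinj : Set.InjOn m M) (hL : ∀ u ∈ M, L u (m u))
    (hf : ∀ u ∈ M, f (m u) = f u + 1) (g : ℕ) (hg : g + 2 * s ≤ Fintype.card V) :
    ∃ τ : Equiv.Perm V, (∀ j < s, τ (q j 1) = q j 1 ∧ τ (q j 2) = q j 2) ∧
      (∀ j < s, τ (q j 0) = q j 3) ∧
      (∀ v, (∀ j < s, v ≠ q j 1 ∧ v ≠ q j 2) → ∀ i, 1 ≤ i → i < g → (τ ^ i) v ≠ v) ∧
      (Finset.univ.filter fun v => ¬ L v (τ v)).card + M.card ≤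
        Fintype.card V + (Finset.univ.filter fun v => f v = c).card + 8 * s := by
  have qne : ∀ i < s, ∀ j < s, ∀ k l, k ≠ l → q i k ≠ q j l := fun i hi j hj k l hkl h =>
    hkl (hq.inj i hi j hj k l h).2
  have qin : ∀ k, ∀ i < s, ∀ j < s, q i k = q j k → i = j := fun k i hi j hj h =>
    (hq.inj i hi j hj k k h).1
  set X : Finset V := (Finset.range s ×ˢ Finset.univ).image fun p : ℕ × Fin 4 => q p.1 p.2
    with hX
  have hXc : X.card ≤ 4 * s := by
    refine Finset.card_image_le.trans ?_
    simp [mul_comm]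
  have hXm : ∀ j < s, ∀ k, q j k ∈ X := fun j hj k =>
    Finset.mem_image.2 ⟨(j, k), by simp [hj], rfl⟩
  set D' : Finset V := M.filter fun u => f u ≠ c ∧ u ∉ X ∧ m u ∉ X with hD'
  have hD'm : ∀ u, u ∈ D' ↔ u ∈ M ∧ f u ≠ c ∧ u ∉ X ∧ m u ∉ X := fun u => Finset.mem_filter
  set e : V → V := fun u => if u ∈ D' then m u else
    if h : ∃ j < s, u = q j 0 then q h.choose 3 else u with he
  have qD' : ∀ j < s, ∀ k, q j k ∉ D' := fun j hj k h => ((hD'm _).1 h).2.2.1 (hXm j hj k)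
  have eD : ∀ u ∈ D', e u = m u := fun u hu => if_pos hu
  have e0 : ∀ j < s, e (q j 0) = q j 3 := by
    intro j hj
    have h : ∃ i < s, q j 0 = q i 0 := ⟨j, hj, rfl⟩
    simp only [he, if_neg (qD' j hj 0), dif_pos h]
    rw [← qin 0 j hj _ h.choose_spec.1 h.choose_spec.2]
  have e12 : ∀ j < s, ∀ k, k ≠ 0 → e (q j k) = q j k := by
    intro j hj k hk
    have h : ¬ ∃ i < s, q j k = q i 0 := fun ⟨i, hi, h⟩ => qne j hj i hi _ _ hk h
    simp only [he, if_neg (qD' j hj k), dif_neg h]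
  set Y : Finset V := ((Finset.range s).image fun j => q j 0) ∪
    ((Finset.range s).image (fun j => q j 1) ∪ (Finset.range s).image fun j => q j 2) with hY
  have hYm : ∀ u, u ∈ Y ↔ ∃ j < s, u = q j 0 ∨ u = q j 1 ∨ u = q j 2 := by
    intro u
    simp only [hY, Finset.mem_union, Finset.mem_image, Finset.mem_range]
    constructor
    · rintro (⟨j, hj, rfl⟩ | ⟨j, hj, rfl⟩ | ⟨j, hj, rfl⟩) <;> exact ⟨j, hj, by simp⟩
    · rintro ⟨j, hj, rfl | rfl | rfl⟩
      · exact Or.inl ⟨j, hj, rfl⟩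
      · exact Or.inr (Or.inl ⟨j, hj, rfl⟩)
      · exact Or.inr (Or.inr ⟨j, hj, rfl⟩)
  have eYX : ∀ u ∈ Y, e u ∈ X := by
    intro u hu
    obtain ⟨j, hj, rfl | rfl | rfl⟩ := (hYm u).1 hu
    · rw [e0 j hj]; exact hXm j hj 3
    · rw [e12 j hj 1 (by decide)]; exact hXm j hj 1
    · rw [e12 j hj 2 (by decide)]; exact hXm j hj 2
  have eDX : ∀ u ∈ D', e u ∉ X := fun u hu => by
    rw [eD u hu]; exact ((hD'm u).1 hu).2.2.2
  have einj : Set.InjOn e (D' ∪ Y : Finset V) := by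
    intro u hu v hv h
    rw [Finset.mem_coe, Finset.mem_union] at hu hv
    rcases hu with hu | hu <;> rcases hv with hv | hv
    · rw [eD u hu, eD v hv] at h
      exact hinj ((hD'm u).1 hu).1 ((hD'm v).1 hv).1 h
    · exact absurd (h ▸ eYX v hv) (eDX u hu)
    · exact absurd (h ▸ eYX u hu) (eDX v hv)
    · obtain ⟨i, hi, rfl | rfl | rfl⟩ := (hYm u).1 hu <;>
      obtain ⟨j, hj, rfl | rfl | rfl⟩ := (hYm v).1 hv <;>
      simp only [e0 i hi, e0 j hj, e12 i hi 1 (by decide), e12 j hj 1 (by decide),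
        e12 i hi 2 (by decide), e12 j hj 2 (by decide)] at h
      · rw [qin _ i hi j hj h]
      · exact absurd h (qne i hi j hj _ _ (by decide))
      · exact absurd h (qne i hi j hj _ _ (by decide))
      · exact absurd h (qne i hi j hj _ _ (by decide))
      · exact h
      · exact h
      · exact absurd h (qne i hi j hj _ _ (by decide))
      · exact h
      · exact h
  obtain ⟨σ, hσ⟩ := exists_perm_extend _ e einj
  have σD : ∀ u ∈ D', σ u = m u := fun u hu => by
    rw [hσ u (Finset.mem_union_left _ hu), eD u hu]
  have σY : ∀ u ∈ Y, σ u = e u := fun u hu => hσ u (Finset.mem_union_right _ hu)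
  have qY : ∀ j < s, q j 0 ∈ Y ∧ q j 1 ∈ Y ∧ q j 2 ∈ Y := fun j hj =>
    ⟨(hYm _).2 ⟨j, hj, by simp⟩, (hYm _).2 ⟨j, hj, by simp⟩, (hYm _).2 ⟨j, hj, by simp⟩⟩
  set B : Finset V := Finset.univ.filter fun v => v ∉ D' ∪ Y with hB
  obtain ⟨τ, t1, t2, t3⟩ := exists_perm_unite σ B
  have hBm : ∀ v, v ∉ B ↔ v ∈ D' ∪ Y := fun v => by
    rw [hB, Finset.mem_filter, not_and_not_right]
    simp
  have τY : ∀ u ∈ Y, τ u = e u := fun u hu => by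
    rw [t1 u ((hBm u).2 (Finset.mem_union_right _ hu)), σY u hu]
  have τD : ∀ u ∈ D', τ u = m u := fun u hu => by
    rw [t1 u ((hBm u).2 (Finset.mem_union_left _ hu)), σD u hu]
  have hpred : ∀ j < s, σ⁻¹ (q j 0) ∈ B := by
    intro j hj
    by_contra h
    rcases Finset.mem_union.1 ((hBm _).1 h) with h | h
    · apply eDX _ h
      rw [eD _ h, ← σD _ h, Equiv.Perm.inv_def, Equiv.apply_symm_apply]
      exact hXm j hj 0
    · have h1 : e (σ⁻¹ (q j 0)) = q j 0 := by rw [← σY _ h, Equiv.Perm.inv_def, Equiv.apply_symm_apply]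
      obtain ⟨i, hi, h2 | h2 | h2⟩ := (hYm _).1 h <;> rw [h2] at h1
      · rw [e0 i hi] at h1
        exact qne i hi j hj _ _ (by decide) h1
      · rw [e12 i hi 1 (by decide)] at h1
        exact qne i hi j hj _ _ (by decide) h1
      · rw [e12 i hi 2 (by decide)] at h1
        exact qne i hi j hj _ _ (by decide) h1
  have hmeet : ∀ v, (∀ j < s, v ≠ q j 1 ∧ v ≠ q j 2) → ∃ r ∈ B, σ.SameCycle v r := by
    intro v hv
    by_contra hcon
    push Not at hcon
    have key : ∀ i : ℕ, (σ ^ i) v ∈ D' ∧ f ((σ ^ i) v) = f v + i := by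
      have hmem : ∀ i : ℕ, (∀ j < s, (σ ^ i) v ≠ q j 1 ∧ (σ ^ i) v ≠ q j 2) →
          (σ ^ i) v ∈ D' := by
        intro i hi
        have h1 : σ.SameCycle v ((σ ^ i) v) := ⟨(i : ℤ), by simp⟩
        have h2 : (σ ^ i) v ∉ B := fun h => hcon _ h h1
        rcases Finset.mem_union.1 ((hBm _).1 h2) with h | h
        · exact h
        · obtain ⟨j, hj, h' | h' | h'⟩ := (hYm _).1 h
          · refine absurd (h1.trans ?_) (hcon _ (hpred j hj))
            rw [h']
            exact ⟨-1, by simp⟩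
          · exact absurd h' (hi j hj).1
          · exact absurd h' (hi j hj).2
      intro i
      induction i with
      | zero => exact ⟨hmem 0 (by simpa using hv), by simp⟩
      | succ i ih =>
        have e1 : (σ ^ (i + 1)) v = m ((σ ^ i) v) := by
          rw [pow_succ', Equiv.Perm.mul_apply, σD _ ih.1]
        refine ⟨hmem _ ?_, ?_⟩
        · rw [e1]
          have := ((hD'm _).1 ih.1).2.2.2
          exact fun j hj => ⟨fun h => this (h ▸ hXm j hj 1), fun h => this (h ▸ hXm j hj 2)⟩
        · rw [e1, hf _ ((hD'm _).1 ih.1).1, ih.2]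
          push_cast
          ring
    obtain ⟨h1, h2⟩ := key (c - f v).val
    refine ((hD'm _).1 h1).2.1 ?_
    rw [h2, ZMod.natCast_zmod_val]
    ring
  refine ⟨τ, fun j hj => ⟨?_, ?_⟩, fun j hj => ?_, ?_, ?_⟩
  · rw [τY _ (qY j hj).2.1, e12 j hj 1 (by decide)]
  · rw [τY _ (qY j hj).2.2, e12 j hj 2 (by decide)]
  · rw [τY _ (qY j hj).1, e0 j hj]
  · intro v hv
    refine girth_of_sameCycle τ (Finset.univ.filter fun v => ∀ j < s, v ≠ q j 1 ∧ v ≠ q j 2) g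
      ?_ ?_ v (by simpa using hv)
    · intro u hu w hw
      obtain ⟨r, hr, h⟩ := hmeet u (by simpa using hu)
      obtain ⟨r', hr', h'⟩ := hmeet w (by simpa using hw)
      exact ((t2 _ _ h).trans (t3 r hr r' hr')).trans (t2 _ _ h').symm
    · have hsub : (Finset.univ : Finset V) ⊆
          (Finset.univ.filter fun v => ∀ j < s, v ≠ q j 1 ∧ v ≠ q j 2) ∪
          ((Finset.range s).image (fun j => q j 1) ∪ (Finset.range s).image fun j => q j 2) := by
        intro v _
        by_cases h : ∀ j < s, v ≠ q j 1 ∧ v ≠ q j 2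
        · exact Finset.mem_union_left _ (by simpa using h)
        · push Not at h
          obtain ⟨j, hj, h⟩ := h
          refine Finset.mem_union_right _ ?_
          simp only [Finset.mem_union, Finset.mem_image, Finset.mem_range]
          by_cases h1 : v = q j 1
          · exact Or.inl ⟨j, hj, h1.symm⟩
          · exact Or.inr ⟨j, hj, (h h1).symm⟩
      have c1 := (Finset.card_le_card hsub).trans (Finset.card_union_le _ _)
      have c2 := Finset.card_union_le ((Finset.range s).image fun j => q j 1)
        ((Finset.range s).image fun j => q j 2)
      have c3 := Finset.card_image_le (s := Finset.range s) (f := fun j => q j 1)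
      have c4 := Finset.card_image_le (s := Finset.range s) (f := fun j => q j 2)
      rw [Finset.card_range] at c3 c4
      rw [Finset.card_univ] at c1
      omega
  · have hdis : Disjoint (Finset.univ.filter fun v => ¬ L v (τ v)) D' := by
      rw [Finset.disjoint_left]
      intro v hv hvD
      refine (Finset.mem_filter.1 hv).2 ?_
      rw [τD v hvD]
      exact hL v ((hD'm v).1 hvD).1
    have c1 : (Finset.univ.filter fun v => ¬ L v (τ v)).card + D'.card ≤ Fintype.card V := by
      rw [← Finset.card_union_of_disjoint hdis]
      exact Finset.card_le_univ _
    have hsub : M ⊆ D' ∪ ((Finset.univ.filter fun v => f v = c) ∪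
        (X ∪ M.filter fun u => m u ∈ X)) := by
      intro v hv
      simp only [Finset.mem_union, Finset.mem_filter, Finset.mem_univ, true_and, hD'm]
      tauto
    have c2 := (Finset.card_le_card hsub).trans (Finset.card_union_le _ _)
    have c3 := Finset.card_union_le (Finset.univ.filter fun v => f v = c)
      (X ∪ M.filter fun u => m u ∈ X)
    have c4 := Finset.card_union_le X (M.filter fun u => m u ∈ X)
    have c5 : (M.filter fun u => m u ∈ X).card ≤ X.card :=
      Finset.card_le_card_of_injOn m (fun u hu => (Finset.mem_filter.1 hu).2)
        fun u hu v hv h => hinj (Finset.mem_filter.1 hu).1 (Finset.mem_filter.1 hv).1 h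
    omega

theorem exists_partial_matching [Fintype V] (H : V → V → Prop) (lam : ℝ) (t : ℕ) (hlam : 0 < lam)
    (h : ∑ v, |((Finset.univ.filter fun w => H v w).card : ℝ) - lam| +
      ∑ v, |((Finset.univ.filter fun u => H u v).card : ℝ) - lam| ≤ lam * t) :
    ∃ (M : Finset V) (m : V → V), Set.InjOn m M ∧ (∀ u ∈ M, H u (m u)) ∧
      Fintype.card V ≤ M.card + t := by
  have hall : ∀ A : Finset V, A.card ≤
      (A.biUnion fun u => Finset.univ.filter fun w => H u w).card + t := by
    intro A
    set N := A.biUnion fun u => Finset.univ.filter fun w => H u w with hN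
    have h1 : ∑ u ∈ A, ((Finset.univ.filter fun w => H u w).card : ℝ) ≤
        ∑ w ∈ N, ((Finset.univ.filter fun u => H u w).card : ℝ) := by
      have h2 : ∑ u ∈ A, (Finset.univ.filter fun w => H u w).card =
          ∑ w ∈ N, (A.filter fun u => H u w).card := by
        refine Eq.trans ?_
          (Finset.sum_card_bipartiteAbove_eq_sum_card_bipartiteBelow (s := A) (t := N) H)
        refine Finset.sum_congr rfl fun u hu => congrArg _ ?_
        ext w
        simp only [Finset.mem_filter, Finset.mem_univ, true_and, Finset.bipartiteAbove, hN,
          Finset.mem_biUnion]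
        exact ⟨fun h => ⟨⟨u, hu, h⟩, h⟩, fun h => h.2⟩
      have h3 : ∑ u ∈ A, (Finset.univ.filter fun w => H u w).card ≤
          ∑ w ∈ N, (Finset.univ.filter fun u => H u w).card := by
        rw [h2]
        exact Finset.sum_le_sum fun w _ =>
          Finset.card_le_card (Finset.filter_subset_filter _ (Finset.subset_univ _))
      exact_mod_cast h3
    have h4 : lam * A.card - ∑ u ∈ A, ((Finset.univ.filter fun w => H u w).card : ℝ) ≤
        ∑ v, |((Finset.univ.filter fun w => H v w).card : ℝ) - lam| := by
      refine le_trans ?_ (Finset.sum_le_sum_of_subset_of_nonneg (Finset.subset_univ A)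
        fun _ _ _ => abs_nonneg _)
      rw [mul_comm, ← nsmul_eq_mul, ← Finset.sum_const, ← Finset.sum_sub_distrib]
      exact Finset.sum_le_sum fun v _ => by rw [abs_sub_comm]; exact le_abs_self _
    have h5 : ∑ u ∈ N, ((Finset.univ.filter fun w => H w u).card : ℝ) - lam * N.card ≤
        ∑ v, |((Finset.univ.filter fun w => H w v).card : ℝ) - lam| := by
      refine le_trans ?_ (Finset.sum_le_sum_of_subset_of_nonneg (Finset.subset_univ N)
        fun _ _ _ => abs_nonneg _)
      rw [mul_comm, ← nsmul_eq_mul, ← Finset.sum_const, ← Finset.sum_sub_distrib]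
      exact Finset.sum_le_sum fun v _ => le_abs_self _
    have h6 : lam * A.card ≤ lam * (N.card + t) := by linarith
    exact_mod_cast le_of_mul_le_mul_left h6 hlam
  obtain ⟨F, hF1, hF2⟩ := (Finset.all_card_le_biUnion_card_iff_exists_injective
    (fun u : V => (Finset.univ.filter fun w => H u w).disjSum (Finset.univ : Finset (Fin t)))).1 (by
      intro A
      obtain rfl | ⟨a, ha⟩ := A.eq_empty_or_nonempty
      · simp
      refine (hall A).trans ?_
      have hsub : (A.biUnion fun u => Finset.univ.filter fun w => H u w).disjSum
          (Finset.univ : Finset (Fin t)) ⊆ A.biUnion fun u : V =>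
            (Finset.univ.filter fun w => H u w).disjSum (Finset.univ : Finset (Fin t)) := by
        intro x hx
        rcases Finset.mem_disjSum.1 hx with ⟨w, hw, rfl⟩ | ⟨j, -, rfl⟩
        · obtain ⟨u, hu, huw⟩ := Finset.mem_biUnion.1 hw
          exact Finset.mem_biUnion.2 ⟨u, hu, Finset.inl_mem_disjSum.2 huw⟩
        · exact Finset.mem_biUnion.2 ⟨a, ha, Finset.inr_mem_disjSum.2 (Finset.mem_univ _)⟩
      have := Finset.card_le_card hsub
      rwa [Finset.card_disjSum, Finset.card_univ, Fintype.card_fin] at this)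
  refine ⟨Finset.univ.filter fun u => (F u).isLeft, fun u => (F u).elim id fun _ => u, ?_, ?_, ?_⟩
  · intro u hu v hv huv
    simp only [Finset.coe_filter, Finset.mem_univ, true_and, Set.mem_ofPred_eq] at hu hv
    obtain ⟨a, ha⟩ := Sum.isLeft_iff.1 hu
    obtain ⟨b, hb⟩ := Sum.isLeft_iff.1 hv
    simp only [ha, hb, Sum.elim_inl, id] at huv
    exact hF1 (by rw [ha, hb, huv])
  · intro u hu
    simp only [Finset.mem_filter, Finset.mem_univ, true_and] at hu
    obtain ⟨a, ha⟩ := Sum.isLeft_iff.1 hu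
    have := hF2 u
    rw [ha, Finset.inl_mem_disjSum] at this
    simpa [ha] using this
  · rw [← Finset.card_univ (α := V), ← Finset.card_filter_add_card_filter_not
      (fun u => (F u).isLeft) (s := (Finset.univ : Finset V))]
    refine Nat.add_le_add_left ?_ _
    have : ((Finset.univ.filter fun u => ¬ (F u).isLeft).image F) ⊆
        (Finset.univ : Finset (Fin t)).image Sum.inr := by
      intro x hx
      obtain ⟨u, hu, rfl⟩ := Finset.mem_image.1 hx
      simp only [Finset.mem_filter, Finset.mem_univ, true_and, Sum.not_isLeft] at hu
      obtain ⟨j, hj⟩ := Sum.isRight_iff.1 hu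
      rw [hj]
      exact Finset.mem_image_of_mem _ (Finset.mem_univ _)
    have h2 := Finset.card_le_card this
    rw [Finset.card_image_of_injective _ hF1] at h2
    refine h2.trans (Finset.card_image_le.trans ?_)
    simp

theorem sum_sq_color_deviation_le [Fintype V] (k : ℕ) [NeZero k] (N : Finset V) (v : V)
    (hv : v ∉ N) (c : ZMod k) :
    ∑ f : V → ZMod k, (((N.filter fun u => f u = f v + c).card : ℝ) - N.card / k) ^ 2 ≤
      N.card * (Fintype.card (V → ZMod k) : ℝ) := by
  have hk : (0 : ℝ) < k := by exact_mod_cast Nat.pos_of_ne_zero (NeZero.ne k)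
  have hk1 : (1 : ℝ) ≤ k := by exact_mod_cast Nat.pos_of_ne_zero (NeZero.ne k)
  set X : V → (V → ZMod k) → ℝ := fun u f => (if f u = f v + c then (1 : ℝ) else 0) - 1 / k
    with hX
  have e1 : ∀ f : V → ZMod k, ((N.filter fun u => f u = f v + c).card : ℝ) - N.card / k =
      ∑ u ∈ N, X u f := by
    intro f
    simp only [hX]
    rw [Finset.sum_sub_distrib, Finset.sum_const, nsmul_eq_mul, Finset.sum_boole]
    ring
  have cross : ∀ u ∈ N, ∀ w ∈ N, u ≠ w → ∑ f, X u f * X w f = 0 := by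
    intro u hu w hw huw
    have huv : v ≠ u := fun h => hv (h ▸ hu)
    have h1 : ∀ a : ZMod k, ∑ f, X u f * X w f = ∑ f, X u (f + Pi.single u a) * X w f := by
      intro a
      rw [← Equiv.sum_comp (Equiv.addRight (Pi.single u a : V → ZMod k))]
      refine Finset.sum_congr rfl fun f _ => ?_
      simp [hX, Pi.single_eq_of_ne huv, Pi.single_eq_of_ne huw.symm]
    have h2 : ∑ a : ZMod k, ∑ f, X u f * X w f = 0 := by
      rw [Finset.sum_congr rfl fun a _ => h1 a, Finset.sum_comm]
      refine Finset.sum_eq_zero fun f _ => ?_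
      rw [← Finset.sum_mul]
      refine mul_eq_zero_of_left ?_ _
      simp only [hX, Pi.add_apply, Pi.single_eq_same, Pi.single_eq_of_ne huv, add_zero]
      rw [Finset.sum_sub_distrib, Finset.sum_const, Finset.card_univ, ZMod.card]
      have : ∀ a : ZMod k, (f u + a = f v + c) = (a = f v + c - f u) := fun a =>
        propext ⟨fun h => by rw [← h]; ring, fun h => by rw [h]; ring⟩
      simp only [this, Finset.sum_ite_eq', Finset.mem_univ, if_true, nsmul_eq_mul]
      field_simp
      simp
    rw [Finset.sum_const, Finset.card_univ, ZMod.card, nsmul_eq_mul] at h2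
    exact (mul_eq_zero.1 h2).resolve_left hk.ne'
  have diag : ∀ u, ∑ f, X u f * X u f ≤ (Fintype.card (V → ZMod k) : ℝ) := by
    intro u
    refine (Finset.sum_le_card_nsmul _ _ 1 fun f _ => ?_).trans (by simp)
    have h0 : 0 < 1 / (k : ℝ) := by positivity
    have h1 : 1 / (k : ℝ) ≤ 1 := by rw [div_le_one hk]; exact hk1
    simp only [hX]
    split_ifs <;> nlinarith
  calc _ = ∑ f, ∑ u ∈ N, ∑ w ∈ N, X u f * X w f := by
        refine Finset.sum_congr rfl fun f _ => ?_
        rw [e1, sq, Finset.sum_mul_sum]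
    _ = ∑ u ∈ N, ∑ w ∈ N, ∑ f, X u f * X w f := by
        rw [Finset.sum_comm]
        exact Finset.sum_congr rfl fun u _ => Finset.sum_comm
    _ = ∑ u ∈ N, ∑ f, X u f * X u f := by
        refine Finset.sum_congr rfl fun u hu => ?_
        exact Finset.sum_eq_single_of_mem u hu fun w hw hwu => cross u hu w hw hwu.symm
    _ ≤ _ := by
        refine (Finset.sum_le_card_nsmul _ _ _ fun u _ => diag u).trans ?_
        rw [nsmul_eq_mul]

theorem exists_coloring [Fintype V] (L : V → V → Prop) (hirr : ∀ v, ¬ L v v) (k : ℕ) [NeZero k] :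
    ∃ f : V → ZMod k,
      ∑ v, |((Finset.univ.filter fun w => L v w ∧ f w = f v + 1).card : ℝ) -
          (Finset.univ.filter fun w => L v w).card / k| +
      ∑ v, |((Finset.univ.filter fun u => L u v ∧ f v = f u + 1).card : ℝ) -
          (Finset.univ.filter fun u => L u v).card / k| ≤
      2 * Fintype.card V * √(Fintype.card V) := by
  set n : ℝ := (Fintype.card V : ℝ) with hn
  set P : (V → ZMod k) → V → ℝ := fun f v =>
    ((Finset.univ.filter fun w => L v w ∧ f w = f v + 1).card : ℝ) -
          (Finset.univ.filter fun w => L v w).card / k with hP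
  set Q : (V → ZMod k) → V → ℝ := fun f v =>
    ((Finset.univ.filter fun u => L u v ∧ f v = f u + 1).card : ℝ) -
          (Finset.univ.filter fun u => L u v).card / k with hQ
  have hPs : ∀ v, ∑ f, P f v ^ 2 ≤ n * (Fintype.card (V → ZMod k) : ℝ) := by
    intro v
    have h := sum_sq_color_deviation_le k (Finset.univ.filter fun w => L v w) v
      (by simpa using hirr v) 1
    simp only [Finset.filter_filter] at h
    refine h.trans (mul_le_mul_of_nonneg_right ?_ (by positivity))
    exact Nat.cast_le.2 (Finset.card_le_univ _)
  have hQs : ∀ v, ∑ f, Q f v ^ 2 ≤ n * (Fintype.card (V → ZMod k) : ℝ) := by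
    intro v
    have h := sum_sq_color_deviation_le k (Finset.univ.filter fun w => L w v) v
      (by simpa using hirr v) (-1)
    simp only [Finset.filter_filter] at h
    have e : ∀ (f : V → ZMod k) u, (f u = f v + -1) = (f v = f u + 1) := fun f u =>
      propext ⟨fun h => by rw [h]; ring, fun h => by rw [h]; ring⟩
    simp only [e] at h
    refine h.trans (mul_le_mul_of_nonneg_right ?_ (by positivity))
    exact Nat.cast_le.2 (Finset.card_le_univ _)
  obtain ⟨f, -, hf⟩ := Finset.exists_le_of_sum_le (s := (Finset.univ : Finset (V → ZMod k)))
    (f := fun f => ∑ v, P f v ^ 2 + ∑ v, Q f v ^ 2) (g := fun _ => 2 * n ^ 2)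
    Finset.univ_nonempty (by
      rw [Finset.sum_add_distrib, Finset.sum_comm, Finset.sum_comm (f := fun f v => Q f v ^ 2),
        Finset.sum_const, Finset.card_univ, nsmul_eq_mul]
      have h1 := Finset.sum_le_card_nsmul Finset.univ _ _ fun v _ => hPs v
      have h2 := Finset.sum_le_card_nsmul Finset.univ _ _ fun v _ => hQs v
      rw [Finset.card_univ, nsmul_eq_mul] at h1 h2
      nlinarith)
  refine ⟨f, ?_⟩
  have hn0 : 0 ≤ n := Nat.cast_nonneg _
  have h1 := sq_sum_le_card_mul_sum_sq (s := (Finset.univ : Finset V)) (f := fun v => |P f v|)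
  have h2 := sq_sum_le_card_mul_sum_sq (s := (Finset.univ : Finset V)) (f := fun v => |Q f v|)
  simp only [sq_abs, Finset.card_univ] at h1 h2
  refine abs_le_of_sq_le_sq' (a := ∑ v, |P f v| + ∑ v, |Q f v|) ?_ (by positivity) |>.2
  have h3 : (2 * n * √n) ^ 2 = 4 * n ^ 3 := by
    rw [mul_pow, Real.sq_sqrt hn0]; ring
  rw [h3]
  have h4 : n * (∑ v, P f v ^ 2 + ∑ v, Q f v ^ 2) ≤ n * (2 * n ^ 2) :=
    mul_le_mul_of_nonneg_left hf hn0
  nlinarith [sq_nonneg (∑ v, |P f v| - ∑ v, |Q f v|)]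

theorem exists_hamilton_of_parameters [Fintype V] (D L : V → V → Prop)
    (hLD : ∀ u v, L u v → D u v) (hirr : ∀ v, ¬ D v v) (δ E s g K k b t : ℕ) (hk : 0 < k)
    (hout : ∀ v, δ ≤ (Finset.univ.filter fun u => D v u).card)
    (hin : ∀ v, δ ≤ (Finset.univ.filter fun u => D u v).card)
    (hE : ManyEdges D δ E) (hs : (16 * s + 16) * Fintype.card V ≤ E)
    (hV : 0 < Fintype.card V)
    (hK : (Fintype.card V : ℝ) ^ 2 * (1 - E / (4 * (Fintype.card V : ℝ) ^ 2)) ^ s <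
      (1 / 2 : ℝ) ^ K)
    (hg0 : 0 < g) (hg : (6 * g + 2 * (3 * s)) * Fintype.card V < E)
    (hKg : Fintype.card V ≤ K * g) (hgs : g + 2 * s ≤ Fintype.card V)
    (hb : Fintype.card V ≤ k * b) (d Y : ℝ) (hd : 0 < d)
    (hY : ∑ v, |((Finset.univ.filter fun w => L v w).card : ℝ) - d| +
      ∑ v, |((Finset.univ.filter fun u => L u v).card : ℝ) - d| ≤ Y)
    (ht : 2 * Fintype.card V * √(Fintype.card V) + Y / k ≤ d / k * t) :
    ∃ σ : Equiv.Perm V, IsHamCycle D σ ∧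
      (Finset.univ.filter fun v => ¬ L v (σ v)).card ≤ 4 * t + 4 * b + 35 * s + K := by
  have : NeZero k := ⟨hk.ne'⟩
  have hk0 : (0 : ℝ) < k := by exact_mod_cast hk
  obtain ⟨q, hq, hqK⟩ := exists_gadgets D hirr δ E s K hout hin hE hs hV hK
  obtain ⟨f, hf⟩ := exists_coloring L (fun v h => hirr v (hLD v v h)) k
  obtain ⟨M, m, hm1, hm2, hm3⟩ := exists_partial_matching
    (fun u v => L u v ∧ f v = f u + 1) (d / k) t (by positivity) (by
      refine le_trans ?_ ht
      refine le_trans ?_ (add_le_add hf (div_le_div_of_nonneg_right hY hk0.le))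
      have key : ∀ x y : ℝ, |x - d / k| ≤ |x - y / k| + |y - d| / k := by
        intro x y
        refine (abs_sub_le x (y / k) (d / k)).trans (le_of_eq ?_)
        rw [← sub_div, abs_div, abs_of_pos hk0]
      rw [add_div, Finset.sum_div, Finset.sum_div, add_add_add_comm]
      refine add_le_add ?_ ?_ <;> rw [← Finset.sum_add_distrib] <;>
        exact Finset.sum_le_sum fun v _ => by convert key _ _; rfl)
  obtain ⟨c, hc⟩ := Fintype.exists_card_fiber_le_of_card_le_mul (f := f) (n := b)
    (by rw [ZMod.card]; exact hb)
  obtain ⟨σ, i1, i2, i3, i4⟩ := exists_perm_init hq L f c M m hm1 (fun u hu => (hm2 u hu).1)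
    (fun u hu => (hm2 u hu).2) g hgs
  set W : Finset V := (Finset.range s).image (fun j => q j 1) ∪
    (Finset.range s).image fun j => q j 2 with hW
  set Φ : Finset V := ((Finset.range s).image fun j => q j 0) ∪ W with hΦ
  have hWm : ∀ v, v ∉ W → ∀ j < s, v ≠ q j 1 ∧ v ≠ q j 2 := by
    intro v hv j hj
    simp only [hW, Finset.mem_union, Finset.mem_image, Finset.mem_range, not_or, not_exists,
      not_and] at hv
    exact ⟨Ne.symm (hv.1 j hj), Ne.symm (hv.2 j hj)⟩
  have hWn : ∀ v, (∀ j < s, v ≠ q j 1 ∧ v ≠ q j 2) → v ∉ W := by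
    intro v hv
    simp only [hW, Finset.mem_union, Finset.mem_image, Finset.mem_range, not_or, not_exists,
      not_and]
    exact ⟨fun j hj => Ne.symm (hv j hj).1, fun j hj => Ne.symm (hv j hj).2⟩
  have hΦn : ∀ v, (∀ j < s, v ≠ q j 0 ∧ v ≠ q j 1 ∧ v ≠ q j 2) → v ∉ Φ := by
    intro v hv
    rw [hΦ, Finset.mem_union, not_or]
    refine ⟨?_, hWn v fun j hj => (hv j hj).2⟩
    simp only [Finset.mem_image, Finset.mem_range, not_exists, not_and]
    exact fun j hj => Ne.symm (hv j hj).1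
  have hΦq : ∀ j < s, q j 0 ∈ Φ ∧ q j 1 ∈ Φ ∧ q j 2 ∈ Φ := by
    intro j hj
    have hj' := Finset.mem_range.2 hj
    exact ⟨Finset.mem_union_left _ (Finset.mem_image_of_mem _ hj'),
      Finset.mem_union_right _ (Finset.mem_union_left _
        (Finset.mem_image_of_mem (fun j => q j 1) hj')),
      Finset.mem_union_right _ (Finset.mem_union_right _
        (Finset.mem_image_of_mem (fun j => q j 2) hj'))⟩
  have hΦc : Φ.card ≤ 3 * s := by
    have c1 : Φ.card ≤ _ := Finset.card_union_le _ _
    have c2 : W.card ≤ _ := Finset.card_union_le _ _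
    have c3 := Finset.card_image_le (s := Finset.range s) (f := fun j => q j 0)
    have c4 := Finset.card_image_le (s := Finset.range s) (f := fun j => q j 1)
    have c5 := Finset.card_image_le (s := Finset.range s) (f := fun j => q j 2)
    rw [Finset.card_range] at c3 c4 c5
    omega
  obtain ⟨τ, τ1, τ2, τ3, τ4⟩ := exists_perm_eliminate D δ E g W Φ Finset.subset_union_right hg0
    hout hin hE
    (lt_of_le_of_lt (Nat.mul_le_mul_right _ (Nat.add_le_add_left (Nat.mul_le_mul_left _ hΦc) _)) hg)
    (Finset.univ.filter fun v => ¬ L v (σ v)).card σ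
    (fun v hv => i3 v (hWm v hv))
    (Finset.card_le_card fun v hv => by
      simp only [Finset.mem_filter, Finset.mem_univ, true_and] at hv ⊢
      exact fun h => hv.2 (hLD _ _ h))
  obtain ⟨ρ, ρ1, ρ2⟩ := exists_hamilton_of_girth D s g K q hq τ hg0
    (fun j hj => ⟨by rw [τ1 _ (hΦq j hj).2.1, (i1 j hj).1],
      by rw [τ1 _ (hΦq j hj).2.2, (i1 j hj).2]⟩)
    (fun j hj => by rw [τ1 _ (hΦq j hj).1, i2 j hj])
    (fun v hv => τ2 v (hΦn v hv)) (fun v hv => τ3 v (hWn v hv)) hKg hqK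
  refine ⟨ρ, ρ1, ?_⟩
  have hsub : (Finset.univ.filter fun v => ¬ L v (ρ v)) ⊆
      (Finset.univ.filter fun v => ¬ L v (σ v)) ∪ ((Finset.univ.filter fun v => τ v ≠ σ v) ∪
        Finset.univ.filter fun v => ρ v ≠ τ v) := by
    intro v
    simp only [Finset.mem_union, Finset.mem_filter, Finset.mem_univ, true_and]
    intro h
    by_contra hcon
    push Not at hcon
    obtain ⟨h1, h2, h3⟩ := hcon
    rw [h3, h2] at h
    exact h h1
  have c1 := (Finset.card_le_card hsub).trans (Finset.card_union_le _ _)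
  have c2 := Finset.card_union_le (Finset.univ.filter fun v => τ v ≠ σ v)
    (Finset.univ.filter fun v => ρ v ≠ τ v)
  omega

set_option maxHeartbeats 1000000 in
theorem eventually_parameters (c ε : ℝ) (hc : 0 < c) (hc1 : c ≤ 1) (hε : 0 < ε) :
    ∃ K k : ℕ, 0 < k ∧ ∀ᶠ n : ℕ in Filter.atTop, ∃ s g b : ℕ,
      (16 * s + 16 : ℝ) ≤ c * n ∧ (n : ℝ) ^ 2 * (1 - c / 4) ^ s < (1 / 2 : ℝ) ^ K ∧ 0 < g ∧
      (6 * g + 2 * (3 * s) : ℝ) < c * n ∧ n ≤ K * g ∧ g + 2 * s ≤ n ∧ n ≤ k * b ∧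
      4 * (18 * k * √n + 1) + 4 * b + 35 * s + K ≤ ε * n := by
  set η := min (c / 200) (ε / 1000) with hη
  have hη0 : 0 < η := by positivity
  have hη1 : η ≤ c / 200 := min_le_left _ _
  have hη2 : η ≤ ε / 1000 := min_le_right _ _
  set K := ⌈48 / c⌉₊ with hK
  set k := ⌈40 / ε⌉₊ with hk
  have hk1 : 40 / ε ≤ k := Nat.le_ceil _
  have hK1 : 48 / c ≤ K := Nat.le_ceil _
  have hk0 : (0 : ℝ) < k := lt_of_lt_of_le (by positivity) hk1
  have hk40 : 40 ≤ k * ε := by rwa [div_le_iff₀ hε] at hk1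
  have hK48 : 48 ≤ K * c := by rwa [div_le_iff₀ hc] at hK1
  refine ⟨K, k, by exact_mod_cast hk0, ?_⟩
  have hcast : Filter.Tendsto (fun n : ℕ => (n : ℝ)) Filter.atTop Filter.atTop :=
    tendsto_natCast_atTop_atTop
  have hexp : ∀ᶠ n : ℕ in Filter.atTop, (n : ℝ) ^ 2 * Real.exp (-(c / 4 * η) * n) <
      (1 / 2 : ℝ) ^ K * Real.exp (-(c / 4)) := by
    have h1 := Real.tendsto_pow_mul_exp_neg_atTop_nhds_zero 2
    have h2 := (h1.comp (hcast.const_mul_atTop (by positivity : 0 < c / 4 * η))).const_mul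
      ((c / 4 * η) ^ 2)⁻¹
    rw [mul_zero] at h2
    have h3 := h2.eventually (gt_mem_nhds (by positivity :
      (0 : ℝ) < (1 / 2 : ℝ) ^ K * Real.exp (-(c / 4))))
    filter_upwards [h3] with n hn
    refine lt_of_eq_of_lt ?_ hn
    simp only [Function.comp]
    rw [mul_pow, neg_mul]
    have : c / 4 * η ≠ 0 := by positivity
    field_simp
  filter_upwards [hexp, hcast.eventually_ge_atTop (100 / c), hcast.eventually_ge_atTop 1,
    (Real.tendsto_sqrt_atTop.comp hcast).eventually_ge_atTop (1000 * k / ε),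
    hcast.eventually_ge_atTop (10 * (8 + K) / ε)] with n h1 h2 h3 h4 h5
  rw [div_le_iff₀ hc] at h2
  simp only [Function.comp] at h4
  rw [div_le_iff₀ hε] at h4 h5
  have hs1 : (⌊η * n⌋₊ : ℝ) ≤ η * n := Nat.floor_le (by positivity)
  have hs2 : η * n < ⌊η * n⌋₊ + 1 := Nat.lt_floor_add_one _
  have hg1 : (⌊c * n / 24⌋₊ : ℝ) ≤ c * n / 24 := Nat.floor_le (by positivity)
  have hg2 : c * n / 24 < ⌊c * n / 24⌋₊ + 1 := Nat.lt_floor_add_one _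
  have hb1 : (n : ℝ) / k ≤ ⌈(n : ℝ) / k⌉₊ := Nat.le_ceil _
  have hb2 : (⌈(n : ℝ) / k⌉₊ : ℝ) < n / k + 1 := Nat.ceil_lt_add_one (by positivity)
  set s := ⌊η * n⌋₊
  set g := ⌊c * n / 24⌋₊
  set b := ⌈(n : ℝ) / k⌉₊
  have hn0 : (0 : ℝ) ≤ n := by positivity
  have hsc : (s : ℝ) ≤ c / 200 * n := hs1.trans (mul_le_mul_of_nonneg_right hη1 hn0)
  have hsε : (s : ℝ) ≤ ε / 1000 * n := hs1.trans (mul_le_mul_of_nonneg_right hη2 hn0)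
  have hcn : c * n ≤ n := by nlinarith
  have hg3 : c * n / 48 ≤ g := by nlinarith
  refine ⟨s, g, b, by nlinarith, ?_, ?_, by nlinarith, ?_, ?_, ?_, ?_⟩
  · have e1 : (1 - c / 4) ^ s ≤ Real.exp (-(c / 4 * s)) := by
      rw [mul_comm, ← mul_neg, Real.exp_nat_mul]
      refine pow_le_pow_left₀ (by linarith) ?_ s
      have := Real.add_one_le_exp (-(c / 4))
      linarith
    have e2 : Real.exp (-(c / 4 * s)) ≤ Real.exp (-(c / 4 * η) * n) * Real.exp (c / 4) := by
      rw [← Real.exp_add, Real.exp_le_exp]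
      nlinarith
    calc (n : ℝ) ^ 2 * (1 - c / 4) ^ s
        ≤ (n : ℝ) ^ 2 * (Real.exp (-(c / 4 * η) * n) * Real.exp (c / 4)) :=
          mul_le_mul_of_nonneg_left (e1.trans e2) (by positivity)
      _ = (n : ℝ) ^ 2 * Real.exp (-(c / 4 * η) * n) * Real.exp (c / 4) := by ring
      _ < (1 / 2 : ℝ) ^ K * Real.exp (-(c / 4)) * Real.exp (c / 4) :=
          mul_lt_mul_of_pos_right h1 (Real.exp_pos _)
      _ = (1 / 2 : ℝ) ^ K := by rw [mul_assoc, ← Real.exp_add]; simp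
  · have : (0 : ℝ) < g := by nlinarith
    exact_mod_cast this
  · have : (n : ℝ) ≤ K * g := by
      have := mul_le_mul_of_nonneg_left hg3 (Nat.cast_nonneg K)
      nlinarith
    exact_mod_cast this
  · have : (g : ℝ) + 2 * s ≤ n := by nlinarith
    exact_mod_cast this
  · rw [div_le_iff₀ hk0] at hb1
    have : (n : ℝ) ≤ k * b := by linarith
    exact_mod_cast this
  · have e1 : (n : ℝ) / k ≤ ε * n / 40 := by
      rw [div_le_div_iff₀ hk0 (by norm_num)]
      nlinarith
    have e2 : √(n : ℝ) * √n = n := Real.mul_self_sqrt hn0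
    have e3 : 1000 * k * √(n : ℝ) ≤ ε * n := by
      have := mul_le_mul_of_nonneg_right h4 (Real.sqrt_nonneg n)
      nlinarith
    nlinarith

theorem exists_hamilton_few_deviations (c ε : ℝ) (hc : 0 < c) (hc1 : c ≤ 1) (hε : 0 < ε) :
    ∃ n₀ : ℕ, ∀ (V : Type) [Fintype V], n₀ ≤ Fintype.card V →
      ∀ (D L : V → V → Prop) (δ E : ℕ) (d Y : ℝ), (∀ u v, L u v → D u v) → (∀ v, ¬ D v v) →
      (∀ v, δ ≤ (Finset.univ.filter fun u => D v u).card) →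
      (∀ v, δ ≤ (Finset.univ.filter fun u => D u v).card) →
      ManyEdges D δ E → c * (Fintype.card V : ℝ) ^ 2 ≤ E → (Fintype.card V : ℝ) / 9 ≤ d →
      ∑ v, |((Finset.univ.filter fun w => L v w).card : ℝ) - d| +
        ∑ v, |((Finset.univ.filter fun u => L u v).card : ℝ) - d| ≤ Y →
      ∃ σ : Equiv.Perm V, IsHamCycle D σ ∧
        ((Finset.univ.filter fun v => ¬ L v (σ v)).card : ℝ) ≤
          36 * Y / Fintype.card V + ε * Fintype.card V := by
  obtain ⟨K, k, hk, hev⟩ := eventually_parameters c (ε / 2) hc hc1 (by positivity)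
  obtain ⟨n₀, hn₀⟩ := Filter.eventually_atTop.1
    (hev.and (tendsto_natCast_atTop_atTop.eventually_ge_atTop (max 1 (8 / ε))))
  refine ⟨n₀, fun V _ hV D L δ E d Y hLD hirr hout hin hE hEc hd hY => ?_⟩
  obtain ⟨⟨s, g, b, p1, p2, p3, p4, p5, p6, p7, p8⟩, p9⟩ := hn₀ _ hV
  set n := Fintype.card V with hn
  have hn1 : (1 : ℝ) ≤ n := (le_max_left _ _).trans p9
  have hn2 : 8 / ε ≤ (n : ℝ) := (le_max_right _ _).trans p9
  rw [div_le_iff₀ hε] at hn2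
  have hn0 : 0 < n := by exact_mod_cast lt_of_lt_of_le one_pos hn1
  have hk0 : (0 : ℝ) < k := by exact_mod_cast hk
  have hd0 : 0 < d := lt_of_lt_of_le (by positivity) hd
  have hY0 : 0 ≤ Y := le_trans (by positivity) hY
  set x : ℝ := (2 * n * √n + Y / k) * k / d with hx
  have hx0 : 0 ≤ x := by positivity
  have hxle : x ≤ 18 * k * √n + 9 * Y / n := by
    have h1 : x ≤ (2 * n * √n + Y / k) * k / (n / 9) :=
      div_le_div_of_nonneg_left (by positivity) (by positivity) hd
    refine h1.trans (le_of_eq ?_)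
    field_simp
    ring
  have ht1 : x ≤ ⌈x⌉₊ := Nat.le_ceil _
  have ht2 : (⌈x⌉₊ : ℝ) < x + 1 := Nat.ceil_lt_add_one hx0
  have hE1 : (E : ℝ) ≤ (n : ℝ) ^ 2 := by
    have hv : Nonempty V := Fintype.card_pos_iff.1 hn0
    have h1 := hE Finset.univ Finset.univ
      ((hout (Classical.arbitrary V)).trans (Finset.card_filter_le _ _))
      ((hout (Classical.arbitrary V)).trans (Finset.card_filter_le _ _))
    have h2 : E ≤ n ^ 2 := by
      refine h1.trans ((Finset.card_filter_le _ _).trans ?_)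
      simp [hn, sq]
    exact_mod_cast h2
  obtain ⟨σ, hσ1, hσ2⟩ := exists_hamilton_of_parameters D L hLD hirr δ E s g K k b ⌈x⌉₊ hk hout hin
    hE
    (by
      have : ((16 * s + 16 : ℕ) : ℝ) * n ≤ E := by push_cast; nlinarith
      exact_mod_cast this)
    hn0
    (by
      refine lt_of_le_of_lt ?_ p2
      refine mul_le_mul_of_nonneg_left ?_ (by positivity)
      have h1 : c / 4 ≤ E / (4 * (n : ℝ) ^ 2) := by
        rw [div_le_div_iff₀ (by norm_num) (by positivity)]
        nlinarith
      have h2 : E / (4 * (n : ℝ) ^ 2) ≤ 1 := by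
        rw [div_le_one (by positivity)]
        nlinarith
      exact pow_le_pow_left₀ (by linarith) (by linarith) s)
    p3
    (by
      have : ((6 * g + 2 * (3 * s) : ℕ) : ℝ) * n < E := by push_cast; nlinarith
      exact_mod_cast this)
    p5 p6 p7 d Y hd0 hY
    (by
      have h1 : 2 * n * √n + Y / k = d / k * x := by rw [hx]; field_simp
      rw [h1]
      exact mul_le_mul_of_nonneg_left ht1 (by positivity))
  refine ⟨σ, hσ1, (Nat.cast_le.2 hσ2).trans ?_⟩
  push_cast
  have e1 : 4 * (9 * Y / n) = 36 * Y / n := by ring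
  nlinarith

theorem sum_exp_signed_card_le {α : Type*} [Fintype α] (B : Finset α) (t : ℝ) :
    ∑ A : Finset α, Real.exp (t * (2 * ((B ∩ A).card : ℝ) - B.card)) ≤
      2 ^ Fintype.card α * Real.exp (Fintype.card α * (t ^ 2 / 2)) := by
  have h1 : ∀ A : Finset α, Real.exp (t * (2 * ((B ∩ A).card : ℝ) - B.card)) =
      (∏ a ∈ A, if a ∈ B then Real.exp t else 1) *
        ∏ a ∈ Finset.univ \ A, if a ∈ B then Real.exp (-t) else 1 := by
    intro A
    rw [Finset.prod_ite, Finset.prod_ite]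
    simp only [Finset.prod_const, one_pow, mul_one]
    rw [← Real.exp_nat_mul, ← Real.exp_nat_mul, ← Real.exp_add]
    have e1 : A.filter (fun a => a ∈ B) = B ∩ A := by ext; simp [and_comm]
    have e2 : (Finset.univ \ A).filter (fun a => a ∈ B) = B \ A := by ext; simp [and_comm]
    have e3 : ((B ∩ A).card : ℝ) + (B \ A).card = B.card := by
      exact_mod_cast Finset.card_inter_add_card_sdiff B A
    rw [e1, e2, ← e3]
    congr 1
    ring
  simp only [h1]
  rw [← Finset.powerset_univ, ← Finset.prod_add]
  have h2 : ∀ a ∈ (Finset.univ : Finset α), ((if a ∈ B then Real.exp t else 1) +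
      if a ∈ B then Real.exp (-t) else 1) ≤ 2 * Real.exp (t ^ 2 / 2) := by
    intro a _
    have h3 := Real.cosh_le_exp_half_sq t
    have h4 : 1 ≤ Real.exp (t ^ 2 / 2) := Real.one_le_exp (by positivity)
    rw [Real.cosh_eq] at h3
    split_ifs <;> linarith
  refine (Finset.prod_le_prod (fun a _ => by positivity) h2).trans (le_of_eq ?_)
  rw [Finset.prod_const, mul_pow, ← Real.exp_nat_mul, Finset.card_univ]

theorem exists_halving_set {α ι : Type*} [Fintype α] [Fintype ι] [Nonempty ι]
    (F : ι → Finset α) (t : ℝ) :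
    ∃ A : Finset α, ∀ i, t * |2 * ((F i ∩ A).card : ℝ) - (F i).card| ≤
      Real.log (2 * Fintype.card ι) + Fintype.card α * (t ^ 2 / 2) := by
  set M : ℝ := 2 * Fintype.card ι * Real.exp (Fintype.card α * (t ^ 2 / 2)) with hM
  set X : ι → Finset α → ℝ := fun i A => 2 * ((F i ∩ A).card : ℝ) - (F i).card with hX
  have hsum : ∑ A : Finset α, ∑ i, (Real.exp (t * X i A) + Real.exp (-t * X i A)) ≤
      ∑ _A : Finset α, M := by
    rw [Finset.sum_comm]
    have h1 : ∀ i ∈ (Finset.univ : Finset ι),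
        ∑ A : Finset α, (Real.exp (t * X i A) + Real.exp (-t * X i A)) ≤
        2 * (2 ^ Fintype.card α * Real.exp (Fintype.card α * (t ^ 2 / 2))) := by
      intro i _
      rw [Finset.sum_add_distrib]
      have h2 := sum_exp_signed_card_le (F i) t
      have h3 := sum_exp_signed_card_le (F i) (-t)
      rw [neg_sq] at h3
      simp only [hX]
      linarith
    refine (Finset.sum_le_sum h1).trans (le_of_eq ?_)
    rw [Finset.sum_const, Finset.sum_const, Finset.card_univ, Finset.card_univ,
      Fintype.card_finset, nsmul_eq_mul, nsmul_eq_mul, hM]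
    push_cast
    ring
  obtain ⟨A, -, hA⟩ := Finset.exists_le_of_sum_le Finset.univ_nonempty hsum
  refine ⟨A, fun i => ?_⟩
  have h1 : Real.exp (t * X i A) + Real.exp (-t * X i A) ≤ M :=
    (Finset.single_le_sum (f := fun i => Real.exp (t * X i A) + Real.exp (-t * X i A))
      (fun i _ => by positivity) (Finset.mem_univ i)).trans hA
  have h2 : Real.exp (t * |X i A|) ≤ M := by
    rcases abs_cases (X i A) with ⟨h, -⟩ | ⟨h, -⟩ <;> rw [h]
    · linarith [Real.exp_pos (-t * X i A)]
    · rw [mul_neg, ← neg_mul]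
      linarith [Real.exp_pos (t * X i A)]
  have hι : (0 : ℝ) < Fintype.card ι := by exact_mod_cast Fintype.card_pos
  have h3 := Real.log_le_log (Real.exp_pos _) h2
  rwa [Real.log_exp, hM, Real.log_mul (by positivity) (Real.exp_pos _).ne', Real.log_exp] at h3

theorem exists_halving_subgraph (η : ℝ) (hη : 0 < η) :
    ∃ n₀ : ℕ, ∀ (V : Type) [Fintype V], n₀ ≤ Fintype.card V → ∀ G : V → V → Prop,
      ∃ L : V → V → Prop, (∀ u v, L u v → G u v) ∧ ∀ S T : Finset V,
        |2 * (((S ×ˢ T).filter fun p => L p.1 p.2).card : ℝ) -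
          ((S ×ˢ T).filter fun p => G p.1 p.2).card| ≤ η * (Fintype.card V : ℝ) ^ 2 := by
  refine ⟨max 1 ⌈6 / η ^ 2⌉₊, fun V _ hV G => ?_⟩
  set n : ℝ := (Fintype.card V : ℝ) with hn
  have hn1 : (1 : ℝ) ≤ n := Nat.one_le_cast.2 ((le_max_left _ _).trans hV)
  have hn2 : 6 / η ^ 2 ≤ n := Nat.ceil_le.1 ((le_max_right _ _).trans hV)
  rw [div_le_iff₀ (by positivity)] at hn2
  obtain ⟨A, hA⟩ := exists_halving_set (fun i : Finset V × Finset V =>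
    (i.1 ×ˢ i.2).filter fun p => G p.1 p.2) η
  refine ⟨fun u v => G u v ∧ (u, v) ∈ A, fun u v h => h.1, fun S T => ?_⟩
  have h3 : Real.log (2 * Fintype.card (Finset V × Finset V)) ≤ 3 * n := by
    rw [Fintype.card_prod, Fintype.card_finset, ← pow_add]
    have h4 : (2 : ℝ) * ((2 ^ (Fintype.card V + Fintype.card V) : ℕ) : ℝ) =
        2 ^ (1 + (Fintype.card V + Fintype.card V)) := by
      push_cast
      ring
    rw [h4, Real.log_pow]
    push_cast
    rw [← hn]
    have h5 := Real.log_two_lt_d9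
    have h6 := Real.log_pos one_lt_two
    nlinarith
  have h1 := (hA (S, T)).trans (add_le_add_left h3 _)
  rw [Fintype.card_prod, Nat.cast_mul, ← hn] at h1
  refine le_of_mul_le_mul_left (le_trans (le_of_eq ?_) (h1.trans ?_)) hη
  · congr 5
    refine congrArg Finset.card ?_
    ext p
    simp [and_assoc]
  · nlinarith

theorem two_mul_card_filter_self [Fintype V] (G : V → V → Prop) (hirr : ∀ x, ¬ G x x)
    (ht : ∀ x y, x ≠ y → (G x y ↔ ¬ G y x)) (A : Finset V) :
    2 * (((A ×ˢ A).filter fun p => G p.1 p.2).card : ℝ) = A.card * A.card - A.card := by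
  have h1 : ((A ×ˢ A).filter fun p => G p.1 p.2).card =
      ((A ×ˢ A).filter fun p => G p.2 p.1).card :=
    Finset.card_equiv (Equiv.prodComm V V) fun p => by simp [and_comm]
  have h2 : A.offDiag = ((A ×ˢ A).filter fun p => G p.1 p.2) ∪
      (A ×ˢ A).filter fun p => G p.2 p.1 := by
    ext ⟨x, y⟩
    simp only [Finset.mem_offDiag, Finset.mem_union, Finset.mem_filter, Finset.mem_product]
    by_cases hxy : x = y
    · subst hxy
      simp [hirr]
    · have := ht x y hxy
      tauto
  have h3 : Disjoint ((A ×ˢ A).filter fun p => G p.1 p.2)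
      ((A ×ˢ A).filter fun p => G p.2 p.1) := by
    rw [Finset.disjoint_filter]
    rintro ⟨x, y⟩ - h4 h5
    have hxy : x ≠ y := fun h => hirr x (by simpa [h] using h4)
    exact (ht x y hxy).1 h4 h5
  have h4 := congrArg Finset.card h2
  rw [Finset.card_union_of_disjoint h3, ← h1, Finset.offDiag_card] at h4
  have h5 : A.card ≤ A.card * A.card := Nat.le_mul_self _
  have h6 : 2 * ((A ×ˢ A).filter fun p => G p.1 p.2).card + A.card = A.card * A.card := by
    omega
  have h7 : 2 * (((A ×ˢ A).filter fun p => G p.1 p.2).card : ℝ) + A.card = A.card * A.card := by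
    exact_mod_cast h6
  linarith

theorem card_filter_product_eq_sum [Fintype V] (G : V → V → Prop) (S T : Finset V) :
    ((S ×ˢ T).filter fun p => G p.1 p.2).card = ∑ u ∈ S, (T.filter fun v => G u v).card := by
  simp only [Finset.card_filter, Finset.sum_product]

theorem card_filter_product_eq_sum_right [Fintype V] (G : V → V → Prop) (S T : Finset V) :
    ((S ×ˢ T).filter fun p => G p.1 p.2).card = ∑ v ∈ T, (S.filter fun u => G u v).card := by
  simp only [Finset.card_filter, Finset.sum_product_right]

theorem regular_tournament_card_edges_ge [Fintype V] (G : V → V → Prop) (hirr : ∀ x, ¬ G x x)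
    (ht : ∀ x y, x ≠ y → (G x y ↔ ¬ G y x)) (r : ℕ)
    (hr : ∀ v, (Finset.univ.filter fun u => G v u).card = r)
    (hrn : Fintype.card V = 2 * r + 1) (hn : 3000 ≤ Fintype.card V) (S T : Finset V)
    (hS : 3 * (Fintype.card V : ℝ) / 8 - 1 / 2 ≤ S.card)
    (hT : 3 * (Fintype.card V : ℝ) / 8 - 1 / 2 ≤ T.card) :
    (Fintype.card V : ℝ) ^ 2 / 900 ≤ ((S ×ˢ T).filter fun p => G p.1 p.2).card := by
  set e : ℝ := (((S ×ˢ T).filter fun p => G p.1 p.2).card : ℝ) with he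
  set A := S ∩ T with hA
  set B := S \ T with hB
  set C := Finset.univ \ (S ∪ T) with hC
  have b1 : A.card * (A.card - 1 : ℝ) ≤ 2 * e := by
    have h1 := two_mul_card_filter_self G hirr ht A
    have h2 : ((A ×ˢ A).filter fun p => G p.1 p.2) ⊆ (S ×ˢ T).filter fun p => G p.1 p.2 :=
      Finset.filter_subset_filter _
        (Finset.product_subset_product Finset.inter_subset_left Finset.inter_subset_right)
    have h3 : (((A ×ˢ A).filter fun p => G p.1 p.2).card : ℝ) ≤ e :=
      Nat.cast_le.2 (Finset.card_le_card h2)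
    linarith
  have hsum : ((S ×ˢ (Finset.univ : Finset V)).filter fun p => G p.1 p.2).card = S.card * r := by
    rw [card_filter_product_eq_sum, Finset.sum_congr rfl fun v _ => hr v, Finset.sum_const,
      smul_eq_mul]
  have hsub : ((S ×ˢ (Finset.univ : Finset V)).filter fun p => G p.1 p.2) ⊆
      ((S ×ˢ T).filter fun p => G p.1 p.2) ∪ ((A ×ˢ B) ∪ (((B ×ˢ B).filter fun p => G p.1 p.2) ∪
        (S ×ˢ C))) := by
    rintro ⟨x, y⟩
    simp only [hA, hB, hC, Finset.mem_union, Finset.mem_filter, Finset.mem_product,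
      Finset.mem_inter, Finset.mem_sdiff, Finset.mem_univ]
    tauto
  have h1 := Finset.card_le_card hsub
  have h2 := h1.trans ((Finset.card_union_le _ _).trans (Nat.add_le_add_left
    ((Finset.card_union_le _ _).trans (Nat.add_le_add_left (Finset.card_union_le _ _) _)) _))
  rw [hsum, Finset.card_product, Finset.card_product] at h2
  have h3 : (S.card : ℝ) * r ≤ e + (A.card * B.card +
      (((B ×ˢ B).filter fun p => G p.1 p.2).card + S.card * C.card)) := by
    rw [he]
    exact_mod_cast h2
  have h4 := two_mul_card_filter_self G hirr ht B
  have h5 : (A.card : ℝ) + B.card = S.card := by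
    exact_mod_cast Finset.card_inter_add_card_sdiff S T
  have h6 : (C.card : ℝ) + B.card + T.card = Fintype.card V := by
    have e1 : C.card + (S ∪ T).card = Fintype.card V := by
      rw [hC, Finset.card_sdiff_add_card, Finset.union_eq_left.2 (Finset.subset_univ _),
        Finset.card_univ]
    have e2 : (S ∪ T).card = B.card + T.card := by rw [hB, Finset.card_sdiff_add_card]
    rw [e2] at e1
    exact_mod_cast (by omega : C.card + B.card + T.card = Fintype.card V)
  have h7 : (Fintype.card V : ℝ) = 2 * r + 1 := by exact_mod_cast hrn
  have hn' : (3000 : ℝ) ≤ Fintype.card V := by exact_mod_cast hn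
  set n : ℝ := (Fintype.card V : ℝ)
  set a : ℝ := (A.card : ℝ)
  set b : ℝ := (B.card : ℝ)
  set s : ℝ := (S.card : ℝ)
  set t : ℝ := (T.card : ℝ)
  have hb0 : 0 ≤ b := Nat.cast_nonneg _
  have hs0 : 0 ≤ s := Nat.cast_nonneg _
  have b2 : s * (-n / 8 - 1) + b * b / 2 ≤ e := by
    have hr' : (r : ℝ) = (n - 1) / 2 := by linarith
    have hc : (C.card : ℝ) = n - t - b := by linarith
    have ha : a = s - b := by linarith
    rw [hr', hc, ha] at h3
    have h8 : s * (3 * n / 8 - 1 / 2) ≤ s * t := mul_le_mul_of_nonneg_left hT hs0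
    nlinarith
  by_cases hcase : n / 20 ≤ a
  · nlinarith
  · push Not at hcase
    have h8 : s - n / 20 ≤ b := by linarith
    have h9 : (s - n / 20) * (s - n / 20) ≤ b * b :=
      mul_self_le_mul_self (by linarith) h8
    nlinarith

theorem sum_abs_le_of_abs_sum_le [Fintype V] (f : V → ℝ) (B : ℝ)
    (h : ∀ S : Finset V, |∑ v ∈ S, f v| ≤ B) : ∑ v, |f v| ≤ 2 * B := by
  rw [← Finset.sum_filter_add_sum_filter_not Finset.univ (fun v => 0 ≤ f v)]
  have h1 := (abs_le.1 (h (Finset.univ.filter fun v => 0 ≤ f v))).2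
  have h2 := (abs_le.1 (h (Finset.univ.filter fun v => ¬ 0 ≤ f v))).1
  have h3 : ∑ v ∈ Finset.univ.filter (fun v => 0 ≤ f v), |f v| =
      ∑ v ∈ Finset.univ.filter (fun v => 0 ≤ f v), f v :=
    Finset.sum_congr rfl fun v hv => abs_of_nonneg (Finset.mem_filter.1 hv).2
  have h4 : ∑ v ∈ Finset.univ.filter (fun v => ¬ 0 ≤ f v), |f v| =
      -∑ v ∈ Finset.univ.filter (fun v => ¬ 0 ≤ f v), f v := by
    rw [← Finset.sum_neg_distrib]
    exact Finset.sum_congr rfl fun v hv => abs_of_neg (not_le.1 (Finset.mem_filter.1 hv).2)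
  rw [h3, h4]
  linarith

theorem sum_abs_degree_sub_le [Fintype V] (G L : V → V → Prop) (r : ℕ) (B : ℝ)
    (hout : ∀ v, (Finset.univ.filter fun u => G v u).card = r)
    (hin : ∀ v, (Finset.univ.filter fun u => G u v).card = r)
    (hB : ∀ S T : Finset V, |2 * (((S ×ˢ T).filter fun p => L p.1 p.2).card : ℝ) -
          ((S ×ˢ T).filter fun p => G p.1 p.2).card| ≤ B) :
    ∑ v, |((Finset.univ.filter fun u => L v u).card : ℝ) - r / 2| ≤ B ∧
      ∑ v, |((Finset.univ.filter fun u => L u v).card : ℝ) - r / 2| ≤ B := by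
  have key : ∀ f : V → ℕ, (∀ S : Finset V, |∑ v ∈ S, (2 * (f v : ℝ) - r)| ≤ B) →
      ∑ v, |(f v : ℝ) - r / 2| ≤ B := by
    intro f hf
    have h1 := sum_abs_le_of_abs_sum_le _ B hf
    have h2 : ∀ v, |2 * (f v : ℝ) - r| = 2 * |(f v : ℝ) - r / 2| := by
      intro v
      rw [← abs_of_pos (two_pos : (0 : ℝ) < 2), ← abs_mul, abs_of_pos (two_pos : (0 : ℝ) < 2)]
      congr 1
      ring
    simp only [h2] at h1
    rw [← Finset.mul_sum] at h1
    linarith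
  constructor
  · refine key _ fun S => ?_
    have h := hB S Finset.univ
    rw [card_filter_product_eq_sum, card_filter_product_eq_sum,
      Finset.sum_congr rfl fun v _ => hout v] at h
    rw [Finset.sum_sub_distrib, ← Finset.mul_sum]
    exact_mod_cast h
  · refine key _ fun S => ?_
    have h := hB Finset.univ S
    rw [card_filter_product_eq_sum_right, card_filter_product_eq_sum_right,
      Finset.sum_congr rfl fun v _ => hin v] at h
    rw [Finset.sum_sub_distrib, ← Finset.mul_sum]
    exact_mod_cast h

/-- `G` with the edges of all the permutations in `I` removed. -/
def edgesAvoiding (G : V → V → Prop) (I : Finset (Equiv.Perm V)) : V → V → Prop :=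
  fun u v => G u v ∧ ∀ τ ∈ I, τ u ≠ v

theorem card_out_edgesAvoiding [Fintype V] (G : V → V → Prop) (I : Finset (Equiv.Perm V))
    (hI : ∀ σ ∈ I, ∀ τ ∈ I, σ ≠ τ → ∀ v, σ v ≠ τ v) (v : V) :
    (Finset.univ.filter fun u => edgesAvoiding G I v u).card + I.card =
      (Finset.univ.filter fun u => G v u).card + (I.filter fun τ => ¬ G v (τ v)).card := by
  have h1 : (Finset.univ.filter fun u => G v u) =
      (Finset.univ.filter fun u => edgesAvoiding G I v u) ∪
        (I.filter fun τ => G v (τ v)).image fun τ => τ v := by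
    ext u
    simp only [Finset.mem_union, Finset.mem_filter, Finset.mem_univ, true_and,
      Finset.mem_image]
    constructor
    · intro h
      by_cases h2 : ∀ τ ∈ I, τ v ≠ u
      · exact Or.inl ⟨h, h2⟩
      · push Not at h2
        obtain ⟨τ, h3, h4⟩ := h2
        exact Or.inr ⟨τ, ⟨h3, h4 ▸ h⟩, h4⟩
    · rintro (h | ⟨τ, h3, h4⟩)
      · exact h.1
      · exact h4 ▸ h3.2
  have h2 : Disjoint (Finset.univ.filter fun u => edgesAvoiding G I v u)
      ((I.filter fun τ => G v (τ v)).image fun τ => τ v) := by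
    rw [Finset.disjoint_left]
    intro u h3 h4
    obtain ⟨τ, h5, h6⟩ := Finset.mem_image.1 h4
    exact (Finset.mem_filter.1 h3).2.2 τ (Finset.mem_filter.1 h5).1 h6
  have h3 : ((I.filter fun τ => G v (τ v)).image fun τ => τ v).card =
      (I.filter fun τ => G v (τ v)).card := by
    refine Finset.card_image_of_injOn fun σ hσ τ hτ hστ => ?_
    by_contra hne
    exact hI σ (Finset.mem_filter.1 hσ).1 τ (Finset.mem_filter.1 hτ).1 hne v hστ
  have h4 := Finset.card_filter_add_card_filter_not (s := I) fun τ => G v (τ v)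
  rw [h1, Finset.card_union_of_disjoint h2, h3]
  omega

theorem card_in_edgesAvoiding [Fintype V] (G : V → V → Prop) (I : Finset (Equiv.Perm V))
    (hI : ∀ σ ∈ I, ∀ τ ∈ I, σ ≠ τ → ∀ v, σ v ≠ τ v) (v : V) :
    (Finset.univ.filter fun u => edgesAvoiding G I u v).card + I.card =
      (Finset.univ.filter fun u => G u v).card + (I.filter fun τ => ¬ G (τ.symm v) v).card := by
  have h1 : (Finset.univ.filter fun u => G u v) =
      (Finset.univ.filter fun u => edgesAvoiding G I u v) ∪
        (I.filter fun τ => G (τ.symm v) v).image fun τ => τ.symm v := by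
    ext u
    simp only [Finset.mem_union, Finset.mem_filter, Finset.mem_univ, true_and,
      Finset.mem_image]
    constructor
    · intro h
      by_cases h2 : ∀ τ ∈ I, τ u ≠ v
      · exact Or.inl ⟨h, h2⟩
      · push Not at h2
        obtain ⟨τ, h3, h4⟩ := h2
        have h5 : τ.symm v = u := by rw [← h4, Equiv.symm_apply_apply]
        exact Or.inr ⟨τ, ⟨h3, by rwa [h5]⟩, h5⟩
    · rintro (h | ⟨τ, h3, h4⟩)
      · exact h.1
      · exact h4 ▸ h3.2
  have h2 : Disjoint (Finset.univ.filter fun u => edgesAvoiding G I u v)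
      ((I.filter fun τ => G (τ.symm v) v).image fun τ => τ.symm v) := by
    rw [Finset.disjoint_left]
    intro u h3 h4
    obtain ⟨τ, h5, h6⟩ := Finset.mem_image.1 h4
    exact (Finset.mem_filter.1 h3).2.2 τ (Finset.mem_filter.1 h5).1
      (by rw [← h6, Equiv.apply_symm_apply])
  have h3 : ((I.filter fun τ => G (τ.symm v) v).image fun τ => τ.symm v).card =
      (I.filter fun τ => G (τ.symm v) v).card := by
    refine Finset.card_image_of_injOn fun σ hσ τ hτ hστ => ?_
    by_contra hne
    refine hI σ (Finset.mem_filter.1 hσ).1 τ (Finset.mem_filter.1 hτ).1 hne (σ.symm v) ?_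
    rw [Equiv.apply_symm_apply, show σ.symm v = τ.symm v from hστ, Equiv.apply_symm_apply]
  have h4 := Finset.card_filter_add_card_filter_not (s := I) fun τ => G (τ.symm v) v
  rw [h1, Finset.card_union_of_disjoint h2, h3]
  omega

theorem sum_card_filter_out [Fintype V] (L : V → V → Prop) (I : Finset (Equiv.Perm V)) :
    ∑ v, (I.filter fun τ => ¬ L v (τ v)).card =
      ∑ τ ∈ I, (Finset.univ.filter fun v => ¬ L v (τ v)).card := by
  simp only [Finset.card_filter]
  exact Finset.sum_comm

theorem sum_card_filter_in [Fintype V] (L : V → V → Prop) (I : Finset (Equiv.Perm V)) :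
    ∑ v, (I.filter fun τ => ¬ L (τ.symm v) v).card =
      ∑ τ ∈ I, (Finset.univ.filter fun v => ¬ L v (τ v)).card := by
  simp only [Finset.card_filter]
  rw [Finset.sum_comm]
  refine Finset.sum_congr rfl fun τ _ => ?_
  rw [← Equiv.sum_comp τ]
  simp only [Equiv.symm_apply_apply]

theorem sum_abs_degree_edgesAvoiding_le [Fintype V] (L : V → V → Prop)
    (I : Finset (Equiv.Perm V)) (hI : ∀ σ ∈ I, ∀ τ ∈ I, σ ≠ τ → ∀ v, σ v ≠ τ v) (d : ℝ) :
    ∑ v, |((Finset.univ.filter fun u => edgesAvoiding L I v u).card : ℝ) - (d - I.card)| +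
      ∑ v, |((Finset.univ.filter fun u => edgesAvoiding L I u v).card : ℝ) - (d - I.card)| ≤
    ∑ v, |((Finset.univ.filter fun u => L v u).card : ℝ) - d| +
      ∑ v, |((Finset.univ.filter fun u => L u v).card : ℝ) - d| +
      2 * (∑ τ ∈ I, (Finset.univ.filter fun v => ¬ L v (τ v)).card : ℕ) := by
  have key : ∀ x y z w : ℕ, x + y = z + w → |(x : ℝ) - (d - y)| ≤ |(z : ℝ) - d| + w := by
    intro x y z w h
    have h1 : (x : ℝ) + y = z + w := by exact_mod_cast h
    have h2 : (x : ℝ) - (d - y) = (z - d) + w := by linarith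
    rw [h2]
    refine (abs_add_le _ _).trans ?_
    rw [Nat.abs_cast]
  have h1 := Finset.sum_le_sum fun v (_ : v ∈ Finset.univ) =>
    key _ _ _ _ (card_out_edgesAvoiding L I hI v)
  have h2 := Finset.sum_le_sum fun v (_ : v ∈ Finset.univ) =>
    key _ _ _ _ (card_in_edgesAvoiding L I hI v)
  rw [Finset.sum_add_distrib, ← Nat.cast_sum] at h1 h2
  rw [sum_card_filter_out] at h1
  rw [sum_card_filter_in] at h2
  linarith

theorem card_edges_edgesAvoiding_ge [Fintype V] (G L : V → V → Prop)
    (I : Finset (Equiv.Perm V)) (S T : Finset V) :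
    ((S ×ˢ T).filter fun p => G p.1 p.2).card ≤
      ((S ×ˢ T).filter fun p => edgesAvoiding G I p.1 p.2).card +
        ((S ×ˢ T).filter fun p => L p.1 p.2).card +
        ∑ τ ∈ I, (Finset.univ.filter fun v => ¬ L v (τ v)).card := by
  have h1 : ((S ×ˢ T).filter fun p => G p.1 p.2) ⊆
      (((S ×ˢ T).filter fun p => edgesAvoiding G I p.1 p.2) ∪
        (S ×ˢ T).filter fun p => L p.1 p.2) ∪
      I.biUnion fun τ => (Finset.univ.filter fun v => ¬ L v (τ v)).image fun v => (v, τ v) := by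
    rintro ⟨u, v⟩ h
    simp only [Finset.mem_filter, Finset.mem_union, Finset.mem_biUnion,
      Finset.mem_image, Finset.mem_univ, true_and] at h ⊢
    by_cases h2 : L u v
    · exact Or.inl (Or.inr ⟨h.1, h2⟩)
    · by_cases h3 : ∀ τ ∈ I, τ u ≠ v
      · exact Or.inl (Or.inl ⟨h.1, h.2, h3⟩)
      · push Not at h3
        obtain ⟨τ, h4, h5⟩ := h3
        exact Or.inr ⟨τ, h4, u, by rwa [h5], by rw [h5]⟩
  refine (Finset.card_le_card h1).trans ((Finset.card_union_le _ _).trans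
    (add_le_add (Finset.card_union_le _ _) (Finset.card_biUnion_le.trans
      (Finset.sum_le_sum fun τ _ => Finset.card_image_le))))

theorem exists_disjoint_hamilton_cycles :
    ∃ n₀ : ℕ, ∀ (V : Type) [Fintype V], n₀ ≤ Fintype.card V → ∀ G : V → V → Prop,
      (∀ x, ¬ G x x) → (∀ x y, x ≠ y → (G x y ↔ ¬ G y x)) → ∀ r : ℕ,
      (∀ v, (Finset.univ.filter fun u => G v u).card = r) →
      (∀ v, (Finset.univ.filter fun u => G u v).card = r) → Fintype.card V = 2 * r + 1 →
      ∃ I : Finset (Equiv.Perm V), (Fintype.card V : ℝ) / 8 ≤ I.card ∧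
        (∀ σ ∈ I, IsHamCycle G σ) ∧ ∀ σ ∈ I, ∀ τ ∈ I, σ ≠ τ → ∀ v, σ v ≠ τ v := by
  set η : ℝ := Real.exp (-9) / 10 ^ 7 with hη
  have hη0 : 0 < η := by positivity
  have hη1 : η ≤ 1 / 10 ^ 7 :=
    div_le_div_of_nonneg_right (Real.exp_le_one_iff.2 (by norm_num)) (by positivity)
  have hη9 : η * Real.exp 9 = 1 / 10 ^ 7 := by
    rw [hη, div_mul_eq_mul_div, ← Real.exp_add]
    simp
  obtain ⟨n₁, h₁⟩ := exists_halving_subgraph η hη0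
  obtain ⟨n₂, h₂⟩ := exists_hamilton_few_deviations (1 / 4000) η (by norm_num) (by norm_num) hη0
  refine ⟨max 3000 (max n₁ n₂), fun V _ hV G hirr ht r hout hin hr => ?_⟩
  have hV0 : 3000 ≤ Fintype.card V := (le_max_left _ _).trans hV
  have hV1 : n₁ ≤ Fintype.card V := (le_max_left _ _).trans ((le_max_right _ _).trans hV)
  have hV2 : n₂ ≤ Fintype.card V := (le_max_right _ _).trans ((le_max_right _ _).trans hV)
  have hne : Nonempty V := Fintype.card_pos_iff.1 (by omega)
  obtain ⟨L, hLG, hL⟩ := h₁ V hV1 G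
  have hdev := sum_abs_degree_sub_le G L r _ hout hin hL
  have hedge := regular_tournament_card_edges_ge G hirr ht r hout hr hV0
  have hstep := h₂ V hV2
  have hn : (3000 : ℝ) ≤ Fintype.card V := by exact_mod_cast hV0
  have hrn : (Fintype.card V : ℝ) = 2 * r + 1 := by exact_mod_cast hr
  set n : ℝ := (Fintype.card V : ℝ)
  have hn0 : 0 < n := by linarith
  set w : Equiv.Perm V → ℕ := fun τ => (Finset.univ.filter fun v => ¬ L v (τ v)).card with hw
  have main : ∀ i : ℕ, (i : ℝ) < n / 8 + 1 → ∃ I : Finset (Equiv.Perm V), I.card = i ∧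
      (∀ σ ∈ I, IsHamCycle G σ) ∧ (∀ σ ∈ I, ∀ τ ∈ I, σ ≠ τ → ∀ v, σ v ≠ τ v) ∧
      ((∑ τ ∈ I, w τ : ℕ) : ℝ) ≤ 73 * η * n * i * Real.exp (72 * i / n) := by
    intro i
    induction i with
    | zero => exact fun _ => ⟨∅, by simp⟩
    | succ i ih =>
      intro hi
      push_cast at hi
      obtain ⟨I, hIc, hIH, hId, hIW⟩ := ih (by linarith)
      set W : ℝ := ((∑ τ ∈ I, w τ : ℕ) : ℝ) with hW
      have hi0 : (0 : ℝ) ≤ i := Nat.cast_nonneg _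
      have hWn : W ≤ n ^ 2 / 10 ^ 6 := by
        have e1 : Real.exp (72 * i / n) ≤ Real.exp 9 := by
          rw [Real.exp_le_exp, div_le_iff₀ hn0]
          linarith
        calc W ≤ 73 * η * n * i * Real.exp (72 * i / n) := hIW
          _ ≤ 73 * η * n * (n / 8) * Real.exp 9 := by gcongr; linarith
          _ = 73 / 8 * n ^ 2 * (η * Real.exp 9) := by ring
          _ ≤ n ^ 2 / 10 ^ 6 := by rw [hη9]; nlinarith [sq_nonneg n]
      have hri : (r : ℝ) - i ≤ ((r - i : ℕ) : ℝ) := by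
        rw [sub_le_iff_le_add]
        exact_mod_cast (by omega : r ≤ r - i + i)
      have hM : ManyEdges (edgesAvoiding G I) (r - i) ⌈1 / 4000 * n ^ 2⌉₊ := by
        intro S T hS hT
        have hS' : ((r - i : ℕ) : ℝ) ≤ S.card := by exact_mod_cast hS
        have hT' : ((r - i : ℕ) : ℝ) ≤ T.card := by exact_mod_cast hT
        have e1 := hedge S T (by linarith) (by linarith)
        have e2 := (abs_le.1 (hL S T)).2
        have e3 : (((S ×ˢ T).filter fun p => G p.1 p.2).card : ℝ) ≤
            ((S ×ˢ T).filter fun p => edgesAvoiding G I p.1 p.2).card +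
            ((S ×ˢ T).filter fun p => L p.1 p.2).card + W := by
          rw [hW]
          exact_mod_cast card_edges_edgesAvoiding_ge G L I S T
        have e4 : η * n ^ 2 ≤ 1 / 10 ^ 7 * n ^ 2 := mul_le_mul_of_nonneg_right hη1 (sq_nonneg n)
        refine Nat.ceil_le.2 ?_
        nlinarith [sq_nonneg n]
      have hY := (sum_abs_degree_edgesAvoiding_le L I hId (r / 2)).trans
        (add_le_add_left (add_le_add hdev.1 hdev.2) _)
      obtain ⟨σ, hσ1, hσ2⟩ := hstep (edgesAvoiding G I) (edgesAvoiding L I) (r - i) _ _ _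
        (fun u v h => ⟨hLG u v h.1, h.2⟩) (fun v h => hirr v h.1)
        (fun v => by
          have e1 := card_out_edgesAvoiding G I hId v
          rw [hout v, hIc] at e1
          omega)
        (fun v => by
          have e1 := card_in_edgesAvoiding G I hId v
          rw [hin v, hIc] at e1
          omega)
        hM (Nat.le_ceil _) (by rw [hIc]; linarith) hY
      have hσI : ∀ τ ∈ I, ∀ v, σ v ≠ τ v := fun τ hτ v h => (hσ1.1 v).2 τ hτ h.symm
      have hσn : σ ∉ I := fun h => hσI σ h (Classical.arbitrary V) rfl
      refine ⟨insert σ I, by rw [Finset.card_insert_of_notMem hσn, hIc], ?_, ?_, ?_⟩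
      · intro τ hτ
        rcases Finset.mem_insert.1 hτ with rfl | h
        · exact ⟨fun v => (hσ1.1 v).1, hσ1.2⟩
        · exact hIH τ h
      · intro τ hτ ρ hρ hne v
        rcases Finset.mem_insert.1 hτ with rfl | h <;> rcases Finset.mem_insert.1 hρ with rfl | h'
        · exact absurd rfl hne
        · exact hσI ρ h' v
        · exact (hσI τ h v).symm
        · exact hId τ h ρ h' hne v
      · have e1 : (w σ : ℝ) ≤ 36 * (η * n ^ 2 + η * n ^ 2 + 2 * W) / n + η * n := by
          refine le_trans (Nat.cast_le.2 (Finset.card_le_card fun v hv => ?_)) hσ2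
          simp only [Finset.mem_filter, Finset.mem_univ, true_and] at hv ⊢
          exact fun h => hv h.1
        have e2 : 36 * (η * n ^ 2 + η * n ^ 2 + 2 * W) / n + η * n = 72 / n * W + 73 * η * n := by
          field_simp
          ring
        rw [Finset.sum_insert hσn, Nat.cast_add, ← hW]
        have e3 : 72 / n + 1 ≤ Real.exp (72 / n) := Real.add_one_le_exp _
        have e4 : Real.exp (72 * (i + 1 : ℕ) / n) = Real.exp (72 * i / n) * Real.exp (72 / n) := by
          rw [← Real.exp_add]
          congr 1
          push_cast
          ring
        have hW0 : 0 ≤ W := Nat.cast_nonneg _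
        have e5 : 1 ≤ Real.exp (72 * (i + 1 : ℕ) / n) := Real.one_le_exp (by positivity)
        calc (w σ : ℝ) + W ≤ W * (72 / n + 1) + 73 * η * n * 1 := by linarith
          _ ≤ 73 * η * n * i * Real.exp (72 * i / n) * Real.exp (72 / n) +
              73 * η * n * Real.exp (72 * (i + 1 : ℕ) / n) := by gcongr
          _ = 73 * η * n * (i + 1 : ℕ) * Real.exp (72 * (i + 1 : ℕ) / n) := by
            rw [e4]
            push_cast
            ring
  obtain ⟨I, hI, hI1, hI2, -⟩ := main ⌈n / 8⌉₊ (Nat.ceil_lt_add_one (by positivity))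
  exact ⟨I, by rw [hI]; exact Nat.le_ceil _, hI1, hI2⟩

end

/-- Every sufficiently large regular tournament on `n` vertices contains at least `n/8`
pairwise edge-disjoint Hamilton cycles. -/
theorem regular_tournament_edge_disjoint_hamilton_cycles :
    ∃ n₀ : ℕ, 0 < n₀ ∧ ∀ n : ℕ, n₀ ≤ n →
      ∀ G : Fin n → Fin n → Prop,
        (∀ x, ¬ G x x) →
        (∀ x y : Fin n, x ≠ y → (G x y ↔ ¬ G y x)) →
        (∀ x, outDeg G x = inDeg G x) →
        ∃ (m : ℕ) (σ : Fin m → Equiv.Perm (Fin n)),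
          (n : ℝ) / 8 ≤ (m : ℝ) ∧
          (∀ i, IsHamCycle G (σ i)) ∧
          (∀ i j : Fin m, i ≠ j → ∀ v, σ i v ≠ σ j v) := by
  classical
  obtain ⟨n₀, h⟩ := exists_disjoint_hamilton_cycles
  refine ⟨n₀ + 1, Nat.succ_pos _, fun n hn G hirr ht hreg => ?_⟩
  have ho : ∀ x, outDeg G x = (Finset.univ.filter fun u => G x u).card := fun x => by
    rw [outDeg, outN, ← Set.ncard_coe_finset]
    simp
  have hi : ∀ x, inDeg G x = (Finset.univ.filter fun u => G u x).card := fun x => by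
    rw [inDeg, inN, ← Set.ncard_coe_finset]
    simp
  have hsum : ∀ x, 2 * outDeg G x + 1 = n := by
    intro x
    have e1 : (Finset.univ.filter fun u => G x u) ∪ (Finset.univ.filter fun u => G u x) =
        Finset.univ.erase x := by
      ext u
      simp only [Finset.mem_union, Finset.mem_filter, Finset.mem_univ, true_and,
        Finset.mem_erase, and_true]
      by_cases hux : u = x
      · subst hux
        simp [hirr]
      · have := ht u x hux
        tauto
    have e2 : Disjoint (Finset.univ.filter fun u => G x u) (Finset.univ.filter fun u => G u x) := by
      rw [Finset.disjoint_filter]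
      intro u _ h1 h2
      have hux : u ≠ x := fun h => hirr x (h ▸ h1)
      exact (ht u x hux).1 h2 h1
    have e3 := congrArg Finset.card e1
    rw [Finset.card_union_of_disjoint e2, ← ho, ← hi, ← hreg,
      Finset.card_erase_of_mem (Finset.mem_univ _), Finset.card_univ, Fintype.card_fin] at e3
    omega
  have hdeg : ∀ x, outDeg G x = (n - 1) / 2 := fun x => by
    have := hsum x
    omega
  obtain ⟨I, hI, hI1, hI2⟩ := h (Fin n) (by rw [Fintype.card_fin]; omega) G hirr ht ((n - 1) / 2)
    (fun x => by convert (ho x).symm.trans (hdeg x))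
    (fun x => by convert (hi x).symm.trans ((hreg x).symm.trans (hdeg x)))
    (by have := hsum ⟨0, by omega⟩; rw [Fintype.card_fin]; omega)
  rw [Fintype.card_fin] at hI
  refine ⟨I.card, fun i => (I.equivFin.symm i : Equiv.Perm (Fin n)), hI,
    fun i => hI1 _ (I.equivFin.symm i).2, fun i j hij => hI2 _ (I.equivFin.symm i).2 _
      (I.equivFin.symm j).2 fun h => hij (I.equivFin.symm.injective (Subtype.ext h))⟩

end ArxivOG
end

section
/- For every n ≥ 3 there exists an oriented graph G on n vertices with minimum semi-degree δ⁰(G) = ⌈(3n−4)/8⌉ − 1 which contains no 1-factor, and hence contains no Hamilton cycle. -/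
open Set

namespace ArxivOG

variable {V : Type*}

open Classical in
/-- The `0`-`1` indicator of a proposition. -/
noncomputable def indic (p : Prop) : ℕ := if p then 1 else 0

theorem indic_true : indic True = 1 := if_pos trivial

theorem indic_false : indic False = 0 := if_neg id

theorem outDeg_eq_sum [Fintype V] (G : V → V → Prop) (x : V) :
    outDeg G x = ∑ y, indic (G x y) := by
  classical
  simp only [indic, Finset.sum_boole, outDeg, outN, Set.ncard_eq_toFinset_card']
  simp

theorem inDeg_eq_sum [Fintype V] (G : V → V → Prop) (x : V) :
    inDeg G x = ∑ y, indic (G y x) := by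
  classical
  simp only [indic, Finset.sum_boole, inDeg, inN, Set.ncard_eq_toFinset_card']
  simp

/-- The minimum semi-degree is `t` if `t` bounds all semi-degrees from below and is attained
as an indegree. -/
theorem minSemiDeg_eq {G : V → V → Prop} {t : ℕ} (hout : ∀ x, t ≤ outDeg G x)
    (hin : ∀ x, t ≤ inDeg G x) {v : V} (hv : inDeg G v = t) : minSemiDeg G = t := by
  have h_out : t ≤ minOutDeg G :=
    le_csInf ⟨_, v, rfl⟩ (by rintro _ ⟨x, rfl⟩; exact hout x)
  have h_in : minInDeg G = t :=
    le_antisymm (hv ▸ Nat.sInf_le ⟨v, rfl⟩)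
      (le_csInf ⟨_, v, rfl⟩ (by rintro _ ⟨x, rfl⟩; exact hin x))
  rw [minSemiDeg, h_in, min_eq_right h_out]

/-- The circulant relation on `Fin m` joining `i` to the next `(m - 1) / 2` elements. -/
def circulant (m : ℕ) [NeZero m] (i j : Fin m) : Prop :=
  0 < (j - i).val ∧ (j - i).val ≤ (m - 1) / 2

theorem circulant_asymm (m : ℕ) [NeZero m] (i j : Fin m) (h : circulant m i j) :
    ¬ circulant m j i := by
  obtain ⟨h1, h2⟩ := h
  rintro ⟨h3, h4⟩
  have h5 : (j - i) + (i - j) = 0 := by abel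
  have h6 := congrArg Fin.val h5
  rw [Fin.val_add, Nat.mod_eq_of_lt (by have := (j - i).isLt; omega)] at h6
  simp only [Fin.val_zero] at h6
  omega

theorem sum_val_initial (m : ℕ) [NeZero m] :
    ∑ z : Fin m, indic (0 < z.val ∧ z.val ≤ (m - 1) / 2) = (m - 1) / 2 := by
  rw [Fin.sum_univ_eq_sum_range (fun z => indic (0 < z ∧ z ≤ (m - 1) / 2))]
  have key : ∀ s, ∑ z ∈ Finset.range s, indic (0 < z ∧ z ≤ (m - 1) / 2)
      = min (s - 1) ((m - 1) / 2) := by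
    intro s
    induction s with
    | zero => simp
    | succ s ih =>
      rw [Finset.sum_range_succ, ih]
      unfold indic
      split_ifs <;> omega
  rw [key]
  omega

theorem sum_circulant_out (m : ℕ) [NeZero m] (i : Fin m) :
    ∑ j, indic (circulant m i j) = (m - 1) / 2 :=
  ((Equiv.subRight i).sum_comp
    (fun z : Fin m => indic (0 < z.val ∧ z.val ≤ (m - 1) / 2))).trans (sum_val_initial m)

theorem sum_circulant_in (m : ℕ) [NeZero m] (j : Fin m) :
    ∑ i, indic (circulant m i j) = (m - 1) / 2 :=
  ((Equiv.subLeft j).sum_comp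
    (fun z : Fin m => indic (0 < z.val ∧ z.val ≤ (m - 1) / 2))).trans (sum_val_initial m)

/-- A nearly balanced bipartite relation between `Fin d` and `Fin (d + 1)`: equal parity, and
for odd `d` additionally the pairs `(j - 1, j)` with `j` odd. -/
def parityRel (d i j : ℕ) : Prop :=
  (i + j) % 2 = 0 ∨ d % 2 = 1 ∧ j % 2 = 1 ∧ i + 1 = j

theorem sum_parityRel_left (d : ℕ) (j : Fin (d + 1)) :
    ∑ i : Fin d, indic (parityRel d i j) = (d + 1) / 2 := by
  have key : ∀ s, ∑ i ∈ Finset.range s, indic (parityRel d i j)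
      = (s + 1 - j % 2) / 2 + if d % 2 = 1 ∧ j.val % 2 = 1 ∧ j ≤ s then 1 else 0 := by
    intro s
    induction s with
    | zero => split_ifs <;> simp <;> omega
    | succ s ih =>
      rw [Finset.sum_range_succ, ih]
      unfold parityRel indic
      split_ifs <;> omega
  rw [Fin.sum_univ_eq_sum_range (fun i => indic (parityRel d i j)), key]
  split_ifs <;> omega

theorem sum_parityRel_right (d : ℕ) (i : Fin d) :
    ∑ j : Fin (d + 1), indic (parityRel d i j) = (d + 1) / 2 + (i + 1) % 2 := by
  have key : ∀ s, ∑ j ∈ Finset.range s, indic (parityRel d i j)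
      = (s + 1 - i % 2) / 2 + if d % 2 = 1 ∧ i.val % 2 = 0 ∧ i + 1 < s then 1 else 0 := by
    intro s
    induction s with
    | zero => simp; omega
    | succ s ih =>
      rw [Finset.sum_range_succ, ih]
      unfold parityRel indic
      split_ifs <;> omega
  rw [Fin.sum_univ_eq_sum_range (fun j => indic (parityRel d i j)), key]
  split_ifs <;> omega

theorem sum_indic_not {ι : Type*} [Fintype ι] (p : ι → Prop) :
    ∑ i, indic (¬ p i) = Fintype.card ι - ∑ i, indic (p i) := by
  have h : (∑ i, indic (¬ p i)) + ∑ i, indic (p i) = Fintype.card ι := by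
    rw [← Finset.sum_add_distrib, ← Finset.card_univ, Finset.card_eq_sum_ones]
    exact Finset.sum_congr rfl fun i _ => by unfold indic; split_ifs <;> simp_all
  omega

/-- Häggkvist's graph: classes `A`, `B`, `C`, `D` of sizes `a`, `d + 1`, `c`, `d`, all edges from
each class to the next in the cyclic order, circulant graphs on `A` and `C`, and a nearly balanced
bipartite tournament between `B` and `D`. -/
def haggkvist (a c d : ℕ) [NeZero a] [NeZero c] :
    Fin a ⊕ Fin (d + 1) ⊕ Fin c ⊕ Fin d → Fin a ⊕ Fin (d + 1) ⊕ Fin c ⊕ Fin d → Prop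
  | .inl i, .inl j => circulant a i j
  | .inl _, .inr (.inl _) => True
  | .inr (.inl _), .inr (.inr (.inl _)) => True
  | .inr (.inl j), .inr (.inr (.inr i)) => ¬ parityRel d i j
  | .inr (.inr (.inl i)), .inr (.inr (.inl j)) => circulant c i j
  | .inr (.inr (.inl _)), .inr (.inr (.inr _)) => True
  | .inr (.inr (.inr _)), .inl _ => True
  | .inr (.inr (.inr i)), .inr (.inl j) => parityRel d i j
  | _, _ => False

section haggkvist

variable (a c d : ℕ) [NeZero a] [NeZero c]

theorem haggkvist_isOriented : IsOriented (haggkvist a c d) := by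
  rintro (i | i | i | i) (j | j | j | j) <;>
    simp only [haggkvist, not_true_eq_false, not_false_eq_true, imp_self, imp_true_iff,
      not_not] <;>
    apply circulant_asymm

/-- A permutation along the edges would embed `B ∪ C` into the smaller set `C ∪ D`. -/
theorem haggkvist_no_factor (σ : Equiv.Perm (Fin a ⊕ Fin (d + 1) ⊕ Fin c ⊕ Fin d)) :
    ¬ ∀ v, haggkvist a c d v (σ v) := by
  intro h
  let f : Fin a ⊕ Fin (d + 1) ⊕ Fin c ⊕ Fin d → ℕ :=
    Sum.elim (fun _ => 0) (Sum.elim (fun _ => 1) (Sum.elim (fun _ => 1) fun _ => 0))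
  let g : Fin a ⊕ Fin (d + 1) ⊕ Fin c ⊕ Fin d → ℕ :=
    Sum.elim (fun _ => 0) (Sum.elim (fun _ => 0) (Sum.elim (fun _ => 1) fun _ => 1))
  have hfg : ∀ v w, haggkvist a c d v w → f v ≤ g w := by
    rintro (i | i | i | i) (j | j | j | j) <;> simp [haggkvist, f, g]
  have hsum : ∑ v, f v ≤ ∑ v, g v :=
    (Finset.sum_le_sum fun v _ => hfg v _ (h v)).trans_eq (Equiv.sum_comp σ g)
  simp [Fintype.sum_sum_type, f, g] at hsum
  omega

variable {a c d} {t : ℕ}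

theorem le_outDeg_haggkvist (hA : t ≤ d + (a - 1) / 2) (hC : t ≤ d + (c - 1) / 2)
    (ha : t ≤ a + (d + 1) / 2) (hc : t ≤ c + d / 2) (x) : t ≤ outDeg (haggkvist a c d) x := by
  rw [outDeg_eq_sum]
  rcases x with i | i | i | i <;>
    simp only [Fintype.sum_sum_type, haggkvist, indic_true, indic_false, sum_circulant_out, sum_indic_not,
      sum_parityRel_left, sum_parityRel_right, Finset.sum_const, Finset.card_univ,
      Fintype.card_fin, smul_eq_mul] <;>
    omega

theorem le_inDeg_haggkvist (hA : t ≤ d + (a - 1) / 2) (hC : t ≤ d + (c - 1) / 2)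
    (ha : t ≤ a + (d + 1) / 2) (hc : t ≤ c + d / 2) (x) : t ≤ inDeg (haggkvist a c d) x := by
  rw [inDeg_eq_sum]
  rcases x with i | i | i | i <;>
    simp only [Fintype.sum_sum_type, haggkvist, indic_true, indic_false, sum_circulant_in, sum_indic_not,
      sum_parityRel_left, sum_parityRel_right, Finset.sum_const, Finset.card_univ,
      Fintype.card_fin, smul_eq_mul] <;>
    omega

theorem inDeg_haggkvist_inl (i : Fin a) :
    inDeg (haggkvist a c d) (.inl i) = d + (a - 1) / 2 := by
  rw [inDeg_eq_sum]
  simp only [Fintype.sum_sum_type, haggkvist, indic_true, indic_false, sum_circulant_in,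
    Finset.sum_const, Finset.card_univ, Fintype.card_fin, smul_eq_mul]
  omega

end haggkvist

theorem exists_class_sizes (n : ℕ) (hn : 5 ≤ n) :
    ∃ a c d : ℕ, 0 < a ∧ 0 < c ∧ a + ((d + 1) + (c + d)) = n ∧ (3 * n - 5) / 8 = d + (a - 1) / 2 ∧
      (3 * n - 5) / 8 ≤ d + (c - 1) / 2 ∧ (3 * n - 5) / 8 ≤ a + (d + 1) / 2 ∧
      (3 * n - 5) / 8 ≤ c + d / 2 := by
  obtain ⟨k, r, hr, rfl⟩ : ∃ k r, r < 8 ∧ n = 8 * k + r := ⟨n / 8, n % 8, by omega, by omega⟩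
  interval_cases r
  · exact ⟨2 * k - 1, 2 * k, 2 * k, by omega⟩
  · exact ⟨2 * k, 2 * k, 2 * k, by omega⟩
  · exact ⟨2 * k - 1, 2 * k, 2 * k + 1, by omega⟩
  · exact ⟨2 * k + 1, 2 * k + 1, 2 * k, by omega⟩
  · exact ⟨2 * k, 2 * k + 1, 2 * k + 1, by omega⟩
  · exact ⟨2 * k + 1, 2 * k + 1, 2 * k + 1, by omega⟩
  · exact ⟨2 * k + 1, 2 * k + 2, 2 * k + 1, by omega⟩
  · exact ⟨2 * k + 1, 2 * k + 1, 2 * k + 2, by omega⟩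

theorem exists_oriented_no_factor (n : ℕ) (hn : 3 ≤ n) :
    ∃ G : Fin n → Fin n → Prop, IsOriented G ∧ minSemiDeg G = (3 * n - 5) / 8 ∧
      ¬ ∃ σ : Equiv.Perm (Fin n), ∀ v, G v (σ v) := by
  rcases Nat.lt_or_ge n 5 with h5 | h5
  · refine ⟨fun _ _ => False, fun _ _ h => h.elim, ?_, fun ⟨_, h⟩ => h ⟨0, by omega⟩⟩
    rw [show (3 * n - 5) / 8 = 0 by omega]
    exact minSemiDeg_eq (fun _ => Nat.zero_le _) (fun _ => Nat.zero_le _) (v := ⟨0, by omega⟩)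
      (by simp [inDeg, inN])
  obtain ⟨a, c, d, ha0, hc0, hcard, hA, hC, ha, hc⟩ := exists_class_sizes n h5
  have : NeZero a := ⟨ha0.ne'⟩
  have : NeZero c := ⟨hc0.ne'⟩
  let e : Fin n ≃ Fin a ⊕ Fin (d + 1) ⊕ Fin c ⊕ Fin d :=
    Fintype.equivOfCardEq (by simp [← hcard])
  let G : Fin n → Fin n → Prop := fun x y => haggkvist a c d (e x) (e y)
  have hout : ∀ x, outDeg G x = outDeg (haggkvist a c d) (e x) := fun x => by
      rw [outDeg_eq_sum, outDeg_eq_sum, ← e.sum_comp]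
  have hin : ∀ x, inDeg G x = inDeg (haggkvist a c d) (e x) := fun x => by
      rw [inDeg_eq_sum, inDeg_eq_sum, ← e.sum_comp]
  refine ⟨G, fun x y => haggkvist_isOriented a c d _ _, ?_, ?_⟩
  · refine minSemiDeg_eq (fun x => ?_) (fun x => ?_) (v := e.symm (.inl ⟨0, ha0⟩)) ?_
    · exact hout x ▸ le_outDeg_haggkvist hA.le hC ha hc _
    · exact hin x ▸ le_inDeg_haggkvist hA.le hC ha hc _
    · rw [hin, e.apply_symm_apply, inDeg_haggkvist_inl, hA]
  · rintro ⟨σ, h⟩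
    refine haggkvist_no_factor a c d (e.permCongr σ) fun v => ?_
    simpa [G, Equiv.permCongr_apply] using h (e.symm v)

theorem natCast_div_eq_ceil_sub_one (n : ℕ) (hn : 3 ≤ n) :
    (((3 * n - 5) / 8 : ℕ) : ℤ) = ⌈(3 * (n : ℚ) - 4) / 8⌉ - 1 := by
  rw [eq_sub_iff_add_eq, eq_comm, Int.ceil_eq_iff]
  obtain ⟨t, ht⟩ : ∃ t, t = (3 * n - 5) / 8 := ⟨_, rfl⟩
  rw [← ht]
  have h1 : ((8 * t + 5 : ℕ) : ℚ) ≤ (3 * n : ℕ) := by exact_mod_cast (by omega)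
  have h2 : ((3 * n : ℕ) : ℚ) ≤ (8 * t + 12 : ℕ) := by exact_mod_cast (by omega)
  push_cast at h1 h2 ⊢
  constructor <;> linarith

/-- **Proposition 2 (extremal example, Häggkvist).**
For any `n ≥ 3` there is an oriented graph on `n` vertices with minimum semi-degree
`⌈(3n-4)/8⌉ - 1` which contains no 1-factor, and hence no Hamilton cycle. -/
theorem extremal_example (n : ℕ) (hn : 3 ≤ n) :
    ∃ G : Fin n → Fin n → Prop, IsOriented G ∧
      (minSemiDeg G : ℤ) = ⌈(3 * (n : ℚ) - 4) / 8⌉ - 1 ∧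
      ¬ (∃ σ : Equiv.Perm (Fin n), ∀ v, G v (σ v)) ∧
      ¬ (∃ σ : Equiv.Perm (Fin n), IsHamCycle G σ) := by
  obtain ⟨G, hG, hdeg, hfac⟩ := exists_oriented_no_factor n hn
  exact ⟨G, hG, hdeg ▸ natCast_div_eq_ceil_sub_one n hn, hfac,
    fun ⟨σ, hσ⟩ => hfac ⟨σ, hσ.1⟩⟩

end ArxivOG
end
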